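/- Values of the Green's function of ℤ² with Dirichlet boundary on the diagonal ray D₀: for every u ∈ ℤ²∖D₀, if h : ℤ² → ℝ is a bounded function with h = 0 on D₀, h(v) → 0 as |v| → ∞, and 4·h(v) − ∑_{v' adjacent to v} h(v') equal to 1 if v = u and 0 otherwise for every v ∉ D₀, then for every w ∈ ℤ² the value h(w) lies in ℚ + √2·ℚ + (1/π)·ℚ; that is, h(w) = q₁ + q₂·√2 + q₃/π for some rational numbers q₁, q₂, q₃. -/

import Mathlib

/-- The closed negative diagonal ray `D₀ = {(k,k) : k ≤ 0}` in `ℤ²`. -/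
def D0 : Set (ℤ × ℤ) := {v | v.1 = v.2 ∧ v.1 ≤ 0}

namespace DiagSlit

open MeasureTheory Filter Topology

/-- Lebesgue measure on the period `(-π, π]`. -/
noncomputable def circ : Measure ℝ := volume.restrict (Set.Ioc (-Real.pi) Real.pi)

instance : IsFiniteMeasure circ := by unfold circ; infer_instance

/-- The character `θ ↦ exp (i k θ)`. -/
noncomputable def wave (k : ℤ) (θ : ℝ) : ℂ := Complex.exp ((k : ℂ) * θ * Complex.I)

/-- The Fourier coefficient of `ψ` at the frequency `a`. -/
noncomputable def cf (ψ : ℝ → ℂ) (a : ℤ) : ℂ :=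
  (2 * Real.pi : ℂ)⁻¹ * ∫ θ, wave (-a) θ * ψ θ ∂circ

lemma wave_zero : wave 0 = 1 := by
  funext θ; simp [wave]

lemma wave_add (k l : ℤ) : wave (k + l) = wave k * wave l := by
  funext θ
  simp only [wave, Pi.mul_apply, ← Complex.exp_add]
  congr 1; push_cast; ring

lemma norm_wave (k : ℤ) (θ : ℝ) : ‖wave k θ‖ = 1 := by
  have : (k : ℂ) * θ * Complex.I = ((k * θ : ℝ) : ℂ) * Complex.I := by push_cast; ring
  rw [wave, this, Complex.norm_exp_ofReal_mul_I]

lemma continuous_wave (k : ℤ) : Continuous (wave k) := by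
  unfold wave; fun_prop

lemma star_wave (k : ℤ) : star (wave k) = wave (-k) := by
  funext θ
  simp [wave, ← Complex.exp_conj]

lemma integrable_wave_mul {ψ : ℝ → ℂ} (hψ : Integrable ψ circ) (k : ℤ) :
    Integrable (wave k * ψ) circ :=
  hψ.bdd_mul (c := 1) (continuous_wave k).aestronglyMeasurable
    (Eventually.of_forall fun θ => (norm_wave k θ).le)

lemma integrable_of_continuous {ψ : ℝ → ℂ} (hψ : Continuous ψ) : Integrable ψ circ :=
  (hψ.integrableOn_Icc (μ := volume) (a := -Real.pi) (b := Real.pi)).mono_set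
    Set.Ioc_subset_Icc_self

lemma cf_add {φ ψ : ℝ → ℂ} (hφ : Integrable φ circ) (hψ : Integrable ψ circ) (a : ℤ) :
    cf (φ + ψ) a = cf φ a + cf ψ a := by
  have h := integral_add (integrable_wave_mul hφ (-a)) (integrable_wave_mul hψ (-a))
  simp only [cf, ← mul_add]
  simp only [Pi.mul_apply, ← mul_add] at h
  exact congrArg _ h

lemma cf_neg (ψ : ℝ → ℂ) (a : ℤ) : cf (-ψ) a = -cf ψ a := by
  simp [cf, integral_neg]

lemma cf_sub {φ ψ : ℝ → ℂ} (hφ : Integrable φ circ) (hψ : Integrable ψ circ) (a : ℤ) :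
    cf (φ - ψ) a = cf φ a - cf ψ a := by
  rw [sub_eq_add_neg, cf_add hφ hψ.neg, cf_neg, sub_eq_add_neg]

lemma cf_const_mul (c : ℂ) (ψ : ℝ → ℂ) (a : ℤ) :
    cf ((fun _ => c) * ψ) a = c * cf ψ a := by
  simp only [cf, Pi.mul_apply, mul_left_comm _ c]
  rw [integral_const_mul, mul_left_comm]

lemma cf_wave_mul (k : ℤ) (ψ : ℝ → ℂ) (a : ℤ) : cf (wave k * ψ) a = cf ψ (a - k) := by
  have h : wave (-(a - k)) = wave (-a) * wave k := by rw [← wave_add]; congr 1; ring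
  simp only [cf, h, Pi.mul_apply, mul_assoc]

lemma cf_congr {φ ψ : ℝ → ℂ} (h : φ =ᵐ[circ] ψ) (a : ℤ) : cf φ a = cf ψ a := by
  unfold cf
  congr 1
  exact integral_congr_ae (h.mono fun θ hθ => by simp [hθ])

lemma cf_star (ψ : ℝ → ℂ) (a : ℤ) : cf (star ψ) a = star (cf ψ (-a)) := by
  have h : ∀ θ, wave (-a) θ * star ψ θ = (starRingEnd ℂ) (wave (- -a) θ * ψ θ) := fun θ => by
    rw [map_mul]
    have h := congrFun (star_wave (- -a)) θ
    rw [neg_neg] at h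
    rw [neg_neg, ← h]
    rfl
  simp only [cf, h, integral_conj]
  simp

lemma norm_cf_le (ψ : ℝ → ℂ) (a : ℤ) : ‖cf ψ a‖ ≤ ∫ θ, ‖ψ θ‖ ∂circ := by
  have h1 : ‖∫ θ, wave (-a) θ * ψ θ ∂circ‖ ≤ ∫ θ, ‖ψ θ‖ ∂circ := by
    refine (norm_integral_le_integral_norm _).trans (le_of_eq ?_)
    simp [norm_wave]
  have hpi := Real.pi_gt_three
  have h2 : ‖(2 * Real.pi : ℂ)⁻¹‖ ≤ 1 := by
    rw [norm_inv, norm_mul, Complex.norm_real, Real.norm_of_nonneg Real.pi_pos.le]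
    rw [RCLike.norm_ofNat]
    exact inv_le_one_of_one_le₀ (by linarith)
  rw [cf, norm_mul]
  calc _ ≤ 1 * ∫ θ, ‖ψ θ‖ ∂circ := by gcongr
    _ = _ := one_mul _

lemma cf_tendsto_zero (ψ : ℝ → ℂ) : Tendsto (cf ψ) cofinite (𝓝 0) := by
  have h := (Real.tendsto_integral_exp_smul_cocompact
    (Set.indicator (Set.Ioc (-Real.pi) Real.pi) ψ)).comp
    ((tendsto_cocompact_mul_right₀ (a := (2 * Real.pi)⁻¹) (by positivity)).comp
      Int.tendsto_coe_cofinite)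
  have h2 := h.const_mul ((2 * Real.pi : ℂ)⁻¹)
  rw [mul_zero] at h2
  refine h2.congr fun a => ?_
  simp only [Function.comp, cf, circ]
  rw [← integral_indicator measurableSet_Ioc]
  congr 2
  funext θ
  by_cases hθ : θ ∈ Set.Ioc (-Real.pi) Real.pi
  · simp only [Set.indicator_of_mem hθ, wave, Circle.smul_def, Real.fourierChar_apply, smul_eq_mul]
    congr 2
    push_cast
    have := Complex.ofReal_ne_zero.2 Real.pi_ne_zero
    field_simp
  · simp [Set.indicator_of_notMem hθ]

lemma cf_wave (k a : ℤ) : cf (wave k) a = if a = k then 1 else 0 := by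
  have hpi := Complex.ofReal_ne_zero.2 Real.pi_ne_zero
  have h1 : ∀ θ, wave (-a) θ * wave k θ = Complex.exp ((((k - a : ℤ) : ℂ) * Complex.I) * θ) := by
    intro θ
    rw [← Pi.mul_apply, ← wave_add, wave]
    congr 1; push_cast; ring
  simp only [cf, h1, circ]
  rw [← intervalIntegral.integral_of_le (by linarith [Real.pi_pos])]
  split_ifs with h
  · subst h
    simp
    field_simp
    ring
  · have h2 : ((k - a : ℤ) : ℂ) ≠ 0 := by
      rw [Int.cast_ne_zero]; omega
    rw [integral_exp_mul_complex (mul_ne_zero h2 Complex.I_ne_zero)]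
    have h3 : Complex.exp (((k - a : ℤ) : ℂ) * Complex.I * (Real.pi : ℝ)) =
        Complex.exp (((k - a : ℤ) : ℂ) * Complex.I * ((-Real.pi : ℝ) : ℂ)) := by
      rw [Complex.exp_eq_exp_iff_exists_int]
      exact ⟨k - a, by push_cast; ring⟩
    rw [h3]; simp

/-- The ring `ℚ + √2 ℚ` inside `ℂ`. -/
noncomputable def Q2 : Subring ℂ where
  carrier := {x | ∃ p q : ℚ, x = p + q * (Real.sqrt 2 : ℂ)}
  mul_mem' := by
    rintro _ _ ⟨p, q, rfl⟩ ⟨r, t, rfl⟩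
    refine ⟨p * r + 2 * q * t, p * t + q * r, ?_⟩
    have h : ((Real.sqrt 2 : ℝ) : ℂ) * (Real.sqrt 2 : ℝ) = 2 := by
      rw [← Complex.ofReal_mul, Real.mul_self_sqrt (by norm_num)]; norm_num
    push_cast
    linear_combination (q * t : ℂ) * h
  one_mem' := ⟨1, 0, by simp⟩
  add_mem' := by
    rintro _ _ ⟨p, q, rfl⟩ ⟨r, t, rfl⟩
    exact ⟨p + r, q + t, by push_cast; ring⟩
  zero_mem' := ⟨0, 0, by simp⟩
  neg_mem' := by
    rintro _ ⟨p, q, rfl⟩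
    exact ⟨-p, -q, by push_cast; ring⟩

lemma ratCast_mem_Q2 (q : ℚ) : (q : ℂ) ∈ Q2 := ⟨q, 0, by simp⟩

lemma sqrt_two_mem_Q2 : ((Real.sqrt 2 : ℝ) : ℂ) ∈ Q2 := ⟨0, 1, by simp⟩

lemma star_mem_Q2 {x : ℂ} (hx : x ∈ Q2) : star x ∈ Q2 := by
  obtain ⟨p, q, rfl⟩ := hx
  exact ⟨p, q, by simp⟩

/-- Integrable functions with Fourier coefficients in `Q2`. -/
structure QType (ψ : ℝ → ℂ) : Prop where
  integrable : Integrable ψ circ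
  mem : ∀ a, cf ψ a ∈ Q2

/-- Functions of `QType` with Fourier coefficients supported on a right half-line. -/
structure PlusType (ψ : ℝ → ℂ) : Prop extends QType ψ where
  vanish : ∃ A : ℤ, ∀ a < A, cf ψ a = 0

lemma QType.add {φ ψ : ℝ → ℂ} (hφ : QType φ) (hψ : QType ψ) : QType (φ + ψ) :=
  ⟨hφ.1.add hψ.1, fun a => by
    rw [cf_add hφ.1 hψ.1]; exact add_mem (hφ.2 a) (hψ.2 a)⟩

lemma QType.neg {φ : ℝ → ℂ} (hφ : QType φ) : QType (-φ) :=
  ⟨hφ.1.neg, fun a => by rw [cf_neg]; exact neg_mem (hφ.2 a)⟩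

lemma QType.sub {φ ψ : ℝ → ℂ} (hφ : QType φ) (hψ : QType ψ) : QType (φ - ψ) := by
  rw [sub_eq_add_neg]; exact hφ.add hψ.neg

lemma integrable_star {φ : ℝ → ℂ} (hφ : Integrable φ circ) : Integrable (star φ) circ :=
  (hφ.norm).mono' (Complex.continuous_conj.comp_aestronglyMeasurable hφ.1)
    (Eventually.of_forall fun θ => by simp)

lemma QType.star {φ : ℝ → ℂ} (hφ : QType φ) : QType (star φ) :=
  ⟨integrable_star hφ.1, fun a => by rw [cf_star]; exact star_mem_Q2 (hφ.2 _)⟩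

lemma QType.congr {φ ψ : ℝ → ℂ} (hφ : QType φ) (h : φ =ᵐ[circ] ψ) : QType ψ :=
  ⟨hφ.1.congr h, fun a => by rw [← cf_congr h]; exact hφ.2 a⟩

lemma PlusType.congr {φ ψ : ℝ → ℂ} (hφ : PlusType φ) (h : φ =ᵐ[circ] ψ) : PlusType ψ :=
  ⟨hφ.1.congr h, hφ.2.imp fun A hA a ha => by rw [← cf_congr h]; exact hA a ha⟩

lemma PlusType.add {φ ψ : ℝ → ℂ} (hφ : PlusType φ) (hψ : PlusType ψ) : PlusType (φ + ψ) := by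
  refine ⟨hφ.1.add hψ.1, ?_⟩
  obtain ⟨A, hA⟩ := hφ.2
  obtain ⟨B, hB⟩ := hψ.2
  refine ⟨min A B, fun a ha => ?_⟩
  rw [cf_add hφ.1.1 hψ.1.1, hA a (by omega), hB a (by omega), add_zero]

lemma PlusType.neg {φ : ℝ → ℂ} (hφ : PlusType φ) : PlusType (-φ) :=
  ⟨hφ.1.neg, hφ.2.imp fun A hA a ha => by rw [cf_neg, hA a ha, neg_zero]⟩

lemma PlusType.sub {φ ψ : ℝ → ℂ} (hφ : PlusType φ) (hψ : PlusType ψ) : PlusType (φ - ψ) := by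
  rw [sub_eq_add_neg]; exact hφ.add hψ.neg

lemma PlusType.one : PlusType 1 := by
  rw [← wave_zero]
  refine ⟨⟨integrable_of_continuous (continuous_wave 0), fun a => ?_⟩, 0, fun a ha => ?_⟩
  · rw [cf_wave]; split_ifs
    · exact one_mem _
    · exact zero_mem _
  · rw [cf_wave, if_neg (by omega)]

/-- Laurent polynomials in `exp (i θ)` with coefficients in `Q2`. -/
noncomputable def trigPoly : Subring (ℝ → ℂ) :=
  Subring.closure ({f | ∃ c ∈ Q2, f = fun _ => c} ∪ {wave 1, wave (-1)})

lemma const_mem_trigPoly {c : ℂ} (hc : c ∈ Q2) : (fun _ => c) ∈ trigPoly :=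
  Subring.subset_closure (Or.inl ⟨c, hc, rfl⟩)

lemma wave_one_mem_trigPoly : wave 1 ∈ trigPoly :=
  Subring.subset_closure (Or.inr (Or.inl rfl))

lemma wave_neg_one_mem_trigPoly : wave (-1) ∈ trigPoly :=
  Subring.subset_closure (Or.inr (Or.inr rfl))

lemma star_mem_trigPoly {m : ℝ → ℂ} (hm : m ∈ trigPoly) : star m ∈ trigPoly := by
  refine Subring.closure_induction (p := fun m _ => star m ∈ trigPoly) ?_ ?_ ?_ ?_ ?_ ?_ hm
  · rintro x (⟨c, hc, rfl⟩ | rfl | rfl)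
    · exact const_mem_trigPoly (star_mem_Q2 hc)
    · rw [star_wave]; exact wave_neg_one_mem_trigPoly
    · rw [star_wave]; exact wave_one_mem_trigPoly
  · rw [star_zero]; exact zero_mem _
  · rw [star_one]; exact one_mem _
  · intro x y _ _ hx hy; rw [star_add]; exact add_mem hx hy
  · intro x _ hx; rw [star_neg]; exact neg_mem hx
  · intro x y _ _ hx hy; rw [star_mul']; exact mul_mem hx hy

lemma PlusType.wave_mul {ψ : ℝ → ℂ} (hψ : PlusType ψ) (k : ℤ) : PlusType (wave k * ψ) := by
  refine ⟨⟨integrable_wave_mul hψ.1.1 k, fun a => ?_⟩, ?_⟩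
  · rw [cf_wave_mul]; exact hψ.1.2 _
  · obtain ⟨A, hA⟩ := hψ.2
    exact ⟨A + k, fun a ha => by rw [cf_wave_mul]; exact hA _ (by omega)⟩

lemma QType.wave_mul {ψ : ℝ → ℂ} (hψ : QType ψ) (k : ℤ) : QType (wave k * ψ) :=
  ⟨integrable_wave_mul hψ.1 k, fun a => by rw [cf_wave_mul]; exact hψ.2 _⟩

lemma integrable_const_mul (c : ℂ) {ψ : ℝ → ℂ} (hψ : Integrable ψ circ) :
    Integrable ((fun _ => c) * ψ) circ := hψ.const_mul c

lemma QType.const_mul {ψ : ℝ → ℂ} (hψ : QType ψ) {c : ℂ} (hc : c ∈ Q2) :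
    QType ((fun _ => c) * ψ) :=
  ⟨integrable_const_mul c hψ.1, fun a => by
    rw [cf_const_mul]; exact mul_mem hc (hψ.2 a)⟩

lemma PlusType.const_mul {ψ : ℝ → ℂ} (hψ : PlusType ψ) {c : ℂ} (hc : c ∈ Q2) :
    PlusType ((fun _ => c) * ψ) :=
  ⟨hψ.1.const_mul hc, hψ.2.imp fun A hA a ha => by rw [cf_const_mul, hA a ha, mul_zero]⟩

lemma PlusType.trigPoly_mul {m : ℝ → ℂ} (hm : m ∈ trigPoly) :
    ∀ {ψ : ℝ → ℂ}, PlusType ψ → PlusType (m * ψ) := by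
  refine Subring.closure_induction
    (p := fun m _ => ∀ {ψ : ℝ → ℂ}, PlusType ψ → PlusType (m * ψ)) ?_ ?_ ?_ ?_ ?_ ?_ hm
  · rintro x (⟨c, hc, rfl⟩ | rfl | rfl) ψ hψ
    · exact hψ.const_mul hc
    · exact hψ.wave_mul 1
    · exact hψ.wave_mul (-1)
  · intro ψ hψ; simpa using hψ.sub hψ
  · intro ψ hψ; simpa using hψ
  · intro x y _ _ hx hy ψ hψ; rw [add_mul]; exact (hx hψ).add (hy hψ)
  · intro x _ hx ψ hψ; rw [neg_mul]; exact (hx hψ).neg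
  · intro x y _ _ hx hy ψ hψ; rw [mul_assoc]; exact hx (hy hψ)

lemma QType.trigPoly_mul {m : ℝ → ℂ} (hm : m ∈ trigPoly) :
    ∀ {ψ : ℝ → ℂ}, QType ψ → QType (m * ψ) := by
  refine Subring.closure_induction
    (p := fun m _ => ∀ {ψ : ℝ → ℂ}, QType ψ → QType (m * ψ)) ?_ ?_ ?_ ?_ ?_ ?_ hm
  · rintro x (⟨c, hc, rfl⟩ | rfl | rfl) ψ hψ
    · exact hψ.const_mul hc
    · exact hψ.wave_mul 1
    · exact hψ.wave_mul (-1)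
  · intro ψ hψ; simpa using hψ.sub hψ
  · intro ψ hψ; simpa using hψ
  · intro x y _ _ hx hy ψ hψ; rw [add_mul]; exact (hx hψ).add (hy hψ)
  · intro x _ hx ψ hψ; rw [neg_mul]; exact (hx hψ).neg
  · intro x y _ _ hx hy ψ hψ; rw [mul_assoc]; exact hx (hy hψ)

lemma continuous_of_mem_trigPoly {m : ℝ → ℂ} (hm : m ∈ trigPoly) : Continuous m := by
  refine Subring.closure_induction (p := fun m _ => Continuous m) ?_ ?_ ?_ ?_ ?_ ?_ hm
  · rintro x (⟨c, hc, rfl⟩ | rfl | rfl)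
    · exact continuous_const
    · exact continuous_wave 1
    · exact continuous_wave (-1)
  · exact continuous_const
  · exact continuous_const
  · intro x y _ _ hx hy; exact hx.add hy
  · intro x _ hx; exact hx.neg
  · intro x y _ _ hx hy; exact hx.mul hy

lemma plusType_of_mem_trigPoly {m : ℝ → ℂ} (hm : m ∈ trigPoly) : PlusType m := by
  simpa using PlusType.one.trigPoly_mul hm

/-- A sequence tending to zero that satisfies a two-step recurrence with right-hand side in `Q2`
supported on a half-line has values in `Q2` and is supported on a half-line. -/
lemma mem_and_vanish_of_recurrence {r g : ℤ → ℂ} {ε : ℤ} (hε : ε = 1 ∨ ε = -1)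
    (hr : Tendsto r cofinite (𝓝 0)) (hrec : ∀ a, r (a + 2) + ε * r a = g a)
    (hg : ∀ a, g a ∈ Q2) {A : ℤ} (hA : ∀ a < A, g a = 0) :
    (∀ a, r a ∈ Q2) ∧ ∀ a < A, r a = 0 := by
  have hεn : ‖(ε : ℂ)‖ = 1 := by rcases hε with rfl | rfl <;> simp
  have hz : ∀ a < A, r a = 0 := by
    intro a ha
    have hn : ∀ n : ℕ, ‖r (a - 2 * n)‖ = ‖r a‖ := by
      intro n
      induction n with
      | zero => simp
      | succ n ih =>
        rw [← ih]
        have h1 := hrec (a - 2 * (n + 1 : ℕ))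
        rw [hA _ (by push_cast; omega), show a - 2 * ((n + 1 : ℕ) : ℤ) + 2 = a - 2 * n by
          push_cast; ring] at h1
        rw [eq_neg_of_add_eq_zero_left h1, norm_neg, norm_mul, hεn, one_mul]
    have hinj : Function.Injective fun n : ℕ => a - 2 * (n : ℤ) := by
      intro m n h; simp only at h; omega
    have ht := ((hr.comp hinj.tendsto_cofinite).norm)
    rw [Nat.cofinite_eq_atTop] at ht
    have ht' : Tendsto (fun _ : ℕ => ‖r a‖) atTop (𝓝 ‖(0 : ℂ)‖) := ht.congr fun n => hn n
    simpa using tendsto_nhds_unique tendsto_const_nhds ht'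
  refine ⟨?_, hz⟩
  have hup : ∀ n : ℕ, ∀ a < A + n, r a ∈ Q2 := by
    intro n
    induction n with
    | zero => intro a ha; rw [hz a (by simpa using ha)]; exact zero_mem _
    | succ n ih =>
      intro a ha
      have h1 := hrec (a - 2)
      rw [sub_add_cancel] at h1
      rw [eq_sub_of_add_eq h1]
      exact sub_mem (hg _) (mul_mem (intCast_mem _ _) (ih _ (by push_cast at ha; omega)))
  intro a
  exact hup (a - A + 1).toNat a (by omega)

/-- The cosine as a complex-valued function. -/
noncomputable def cosFn : ℝ → ℂ := fun θ => (Real.cos θ : ℂ)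

lemma two_mul_cosFn : 2 * cosFn = wave 1 + wave (-1) := by
  funext θ
  simp [cosFn, wave, Complex.cos, mul_div_cancel₀]

lemma continuous_cosFn : Continuous cosFn := by unfold cosFn; fun_prop

lemma half_mem_Q2 : (2⁻¹ : ℂ) ∈ Q2 := by simpa using ratCast_mem_Q2 2⁻¹

lemma cosFn_mem_trigPoly : cosFn ∈ trigPoly := by
  have h : cosFn = (fun _ => 2⁻¹) * (wave 1 + wave (-1)) := by
    rw [← two_mul_cosFn]; funext θ; simp
  rw [h]
  exact mul_mem (const_mem_trigPoly half_mem_Q2)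
    (add_mem wave_one_mem_trigPoly wave_neg_one_mem_trigPoly)

lemma cf_two_mul_cosFn_mul {ψ : ℝ → ℂ} (hψ : Integrable ψ circ) (a : ℤ) :
    cf (2 * cosFn * ψ) a = cf ψ (a - 1) + cf ψ (a + 1) := by
  rw [two_mul_cosFn, add_mul, cf_add (integrable_wave_mul hψ _) (integrable_wave_mul hψ _),
    cf_wave_mul, cf_wave_mul, sub_neg_eq_add]

lemma PlusType.of_cosFn_mul {ψ : ℝ → ℂ} (hψ : Integrable ψ circ) (h : PlusType (cosFn * ψ)) :
    PlusType ψ := by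
  have h2 : PlusType (2 * cosFn * ψ) := by
    rw [mul_assoc]; exact h.trigPoly_mul (ofNat_mem trigPoly 2)
  obtain ⟨A, hA⟩ := h2.2
  have key := mem_and_vanish_of_recurrence (r := cf ψ) (g := fun a => cf (2 * cosFn * ψ) (a + 1))
    (Or.inl rfl) (cf_tendsto_zero ψ)
    (fun a => by rw [cf_two_mul_cosFn_mul hψ]; push_cast; rw [one_mul, add_comm]; congr 2 <;> ring)
    (fun a => h2.1.2 _) (A := A - 1) (fun a ha => hA _ (by omega))
  exact ⟨⟨hψ, key.1⟩, _, key.2⟩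

lemma PlusType.of_cosFn_pow_mul {ψ : ℝ → ℂ} (m : ℕ) (hψ : Integrable ψ circ)
    (h : PlusType (cosFn ^ m * ψ)) : PlusType ψ := by
  induction m with
  | zero => simpa using h
  | succ m ih =>
    refine ih (PlusType.of_cosFn_mul ?_ (by rw [← mul_assoc, ← pow_succ']; exact h))
    exact hψ.bdd_mul (c := 1) (continuous_cosFn.pow m).aestronglyMeasurable
      (Eventually.of_forall fun θ => by
        simp only [Pi.pow_apply, norm_pow, cosFn, Complex.norm_real, Real.norm_eq_abs]
        exact pow_le_one₀ (abs_nonneg _) (Real.abs_cos_le_one θ))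

lemma PlusType.of_one_sub_wave_two_mul {ψ : ℝ → ℂ} (hψ : Integrable ψ circ)
    (h : PlusType ((1 - wave 2) * ψ)) : PlusType ψ := by
  obtain ⟨A, hA⟩ := h.2
  have key := mem_and_vanish_of_recurrence (r := cf ψ)
    (g := fun a => cf ((1 - wave 2) * ψ) (a + 2))
    (Or.inr rfl) (cf_tendsto_zero ψ)
    (fun a => by
      rw [sub_mul, one_mul, cf_sub hψ (integrable_wave_mul hψ _), cf_wave_mul]
      push_cast
      rw [add_sub_cancel_right]; ring)
    (fun a => h.1.2 _) (A := A - 2) (fun a ha => hA _ (by omega))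
  exact ⟨⟨hψ, key.1⟩, _, key.2⟩

/-- The normalised central binomial coefficients `4⁻ᵐ (2 m choose m)`. -/
def binom : ℕ → ℚ
  | 0 => 1
  | m + 1 => binom m * ((2 * m + 1) / (2 * m + 2))

/-- The Taylor coefficients of `√(1 - x)`. -/
def rootCoeff : ℕ → ℚ
  | 0 => 1
  | m + 1 => binom (m + 1) - binom m

lemma binom_pos (m : ℕ) : 0 < binom m := by
  induction m with
  | zero => simp [binom]
  | succ m ih => rw [binom]; positivity

lemma rootCoeff_succ (m : ℕ) : rootCoeff (m + 1) = -(binom m / (2 * m + 2)) := by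
  have : (2 * m + 2 : ℚ) ≠ 0 := by positivity
  rw [rootCoeff, binom]; field_simp; ring

lemma abs_rootCoeff_succ (m : ℕ) : |rootCoeff (m + 1)| = binom m - binom (m + 1) := by
  have h : rootCoeff (m + 1) ≤ 0 := by
    rw [rootCoeff_succ, neg_nonpos]
    have := binom_pos m
    positivity
  rw [abs_of_nonpos h, rootCoeff]; ring

lemma rootCoeff_rec (m : ℕ) :
    2 * ((m : ℚ) + 1) * rootCoeff (m + 1) = (2 * m - 1) * rootCoeff m := by
  cases m with
  | zero => simp [rootCoeff, binom]; norm_num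
  | succ m =>
    have h1 : (2 * m + 2 : ℚ) ≠ 0 := by positivity
    have h2 : (2 * (m + 1 : ℕ) + 2 : ℚ) ≠ 0 := by positivity
    rw [rootCoeff_succ, rootCoeff_succ, binom]
    push_cast at h2 ⊢
    field_simp
    ring

lemma sum_antidiagonal_rootCoeff (n : ℕ) :
    ∑ p ∈ Finset.HasAntidiagonal.antidiagonal n, rootCoeff p.1 * rootCoeff p.2 =
      if n = 0 then 1 else if n = 1 then -1 else 0 := by
  set S : PowerSeries ℚ := PowerSeries.mk rootCoeff with hS
  have hder : 2 * (1 - PowerSeries.X) * PowerSeries.derivative ℚ S = -S := by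
    ext m
    rw [mul_assoc, sub_mul, one_mul, show (2 : PowerSeries ℚ) = PowerSeries.C 2 from
      (map_ofNat _ 2).symm,
      PowerSeries.coeff_C_mul, map_sub, map_neg, PowerSeries.coeff_derivative]
    cases m with
    | zero => simp [hS, rootCoeff, binom]; norm_num
    | succ m =>
      rw [PowerSeries.coeff_succ_X_mul, PowerSeries.coeff_derivative]
      simp only [hS, PowerSeries.coeff_mk]
      have h := rootCoeff_rec (m + 1)
      push_cast at h ⊢
      linear_combination h
  have hP : (1 - PowerSeries.X) * PowerSeries.derivative ℚ (S * S) = -(S * S) := by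
    rw [Derivation.leibniz, smul_eq_mul]
    linear_combination S * hder
  have hcoef : ∀ n : ℕ, (n + 1 : ℚ) * PowerSeries.coeff (n + 1) (S * S) =
      (n - 1 : ℚ) * PowerSeries.coeff n (S * S) := by
    intro n
    have h := congrArg (PowerSeries.coeff n) hP
    rw [sub_mul, one_mul, map_sub, map_neg, PowerSeries.coeff_derivative] at h
    cases n with
    | zero => simp at h ⊢; linear_combination h
    | succ n =>
      rw [PowerSeries.coeff_succ_X_mul, PowerSeries.coeff_derivative] at h
      push_cast at h ⊢
      linear_combination h
  have hsum : ∀ n, PowerSeries.coeff n (S * S) =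
      ∑ p ∈ Finset.HasAntidiagonal.antidiagonal n, rootCoeff p.1 * rootCoeff p.2 := by
    intro n; rw [PowerSeries.coeff_mul]; simp [hS]
  rw [← hsum]
  have h0 : PowerSeries.coeff 0 (S * S) = 1 := by rw [hsum]; simp [rootCoeff]
  have h1 : PowerSeries.coeff 1 (S * S) = -1 := by
    have := hcoef 0; rw [h0] at this; simpa using this
  have h2 : ∀ m, PowerSeries.coeff (m + 2) (S * S) = 0 := by
    intro m
    induction m with
    | zero => have := hcoef 1; rw [h1] at this; norm_num at this; simpa using this
    | succ m ih =>
      have := hcoef (m + 2)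
      rw [ih, mul_zero] at this
      exact (mul_eq_zero.1 this).resolve_left (by positivity)
  match n with
  | 0 => simpa using h0
  | 1 => simpa using h1
  | m + 2 => simpa using h2 m

lemma summable_abs_rootCoeff_succ : Summable (fun m => |(rootCoeff (m + 1) : ℝ)|) ∧
    ∑' m, |(rootCoeff (m + 1) : ℝ)| ≤ 1 := by
  have h : ∀ n, ∑ m ∈ Finset.range n, |(rootCoeff (m + 1) : ℝ)| ≤ 1 := by
    intro n
    have h1 : ∑ m ∈ Finset.range n, |rootCoeff (m + 1)| = 1 - binom n := by
      simp only [abs_rootCoeff_succ]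
      rw [Finset.sum_range_sub']
      rfl
    have h2 : ∑ m ∈ Finset.range n, |rootCoeff (m + 1)| ≤ 1 := by
      rw [h1]; linarith [binom_pos n]
    exact_mod_cast h2
  exact ⟨summable_of_sum_range_le (fun _ => abs_nonneg _) h,
    Real.tsum_le_of_sum_range_le (fun _ => abs_nonneg _) h⟩

lemma summable_abs_rootCoeff : Summable (fun m => |(rootCoeff m : ℝ)|) :=
  (summable_nat_add_iff 1).1 summable_abs_rootCoeff_succ.1

/-- The terms of the Fourier series of `slitFn`. -/
noncomputable def slitTerm (m : ℕ) (θ : ℝ) : ℂ := (rootCoeff m : ℂ) * wave (2 * m) θ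

/-- The branch of `√(1 - exp (2 i θ))` with nonnegative real part. -/
noncomputable def slitFn (θ : ℝ) : ℂ := ∑' m, slitTerm m θ

lemma norm_slitTerm (m : ℕ) (θ : ℝ) : ‖slitTerm m θ‖ = |(rootCoeff m : ℝ)| := by
  rw [slitTerm, norm_mul, norm_wave, mul_one, ← Complex.ofReal_ratCast, Complex.norm_real,
    Real.norm_eq_abs]

lemma summable_norm_slitTerm (θ : ℝ) : Summable fun m => ‖slitTerm m θ‖ := by
  simpa only [norm_slitTerm] using summable_abs_rootCoeff

lemma continuous_slitTerm (m : ℕ) : Continuous (slitTerm m) :=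
  continuous_const.mul (continuous_wave _)

lemma continuous_slitFn : Continuous slitFn :=
  continuous_tsum continuous_slitTerm summable_abs_rootCoeff fun m θ => (norm_slitTerm m θ).le

lemma slitFn_sq : slitFn ^ 2 = 1 - wave 2 := by
  funext θ
  rw [Pi.pow_apply, sq, slitFn, tsum_mul_tsum_eq_tsum_sum_antidiagonal_of_summable_norm
    (summable_norm_slitTerm θ) (summable_norm_slitTerm θ)]
  have h : ∀ n, ∑ p ∈ Finset.HasAntidiagonal.antidiagonal n, slitTerm p.1 θ * slitTerm p.2 θ =
      ((if n = 0 then 1 else if n = 1 then -1 else 0 : ℚ) : ℂ) * wave (2 * n) θ := by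
    intro n
    rw [← sum_antidiagonal_rootCoeff, Rat.cast_sum, Finset.sum_mul]
    refine Finset.sum_congr rfl fun p hp => ?_
    rw [← Finset.HasAntidiagonal.mem_antidiagonal.1 hp, slitTerm, slitTerm, Nat.cast_add, mul_add,
      wave_add,
      Pi.mul_apply]
    push_cast; ring
  simp only [h]
  rw [tsum_eq_sum (s := {0, 1}) (fun n hn => by
    simp only [Finset.mem_insert, Finset.mem_singleton, not_or] at hn
    simp [hn.1, hn.2])]
  simp [wave_zero, sub_eq_add_neg]

lemma slitFn_re_nonneg (θ : ℝ) : 0 ≤ (slitFn θ).re := by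
  have hs := summable_norm_slitTerm θ
  have h1 : slitFn θ = 1 + ∑' m, slitTerm (m + 1) θ := by
    rw [slitFn, hs.of_norm.tsum_eq_zero_add]
    simp [slitTerm, rootCoeff, wave_zero]
  have h2 : ‖∑' m, slitTerm (m + 1) θ‖ ≤ 1 := by
    have hs1 : Summable fun m => ‖slitTerm (m + 1) θ‖ := by
      simpa only [norm_slitTerm] using summable_abs_rootCoeff_succ.1
    refine (norm_tsum_le_tsum_norm hs1).trans ?_
    simpa only [norm_slitTerm] using summable_abs_rootCoeff_succ.2
  have h3 := (abs_le.1 ((Complex.abs_re_le_norm (∑' m, slitTerm (m + 1) θ)).trans h2)).1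
  rw [h1, Complex.add_re, Complex.one_re]; linarith

lemma hasSum_cf_slitFn (a : ℤ) :
    HasSum (fun m : ℕ => (rootCoeff m : ℂ) * if a = 2 * m then 1 else 0) (cf slitFn a) := by
  have hi : ∀ m, Integrable (fun θ => wave (-a) θ * slitTerm m θ) circ := fun m =>
    integrable_of_continuous ((continuous_wave _).mul (continuous_slitTerm m))
  have hsum : Summable fun m => ∫ θ, ‖wave (-a) θ * slitTerm m θ‖ ∂circ := by
    simp only [norm_mul, norm_wave, norm_slitTerm, one_mul, integral_const]
    exact summable_abs_rootCoeff.const_smul _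
  have h := (hasSum_integral_of_summable_integral_norm hi hsum).mul_left (2 * Real.pi : ℂ)⁻¹
  have h1 : ∀ θ, ∑' m, wave (-a) θ * slitTerm m θ = wave (-a) θ * slitFn θ := fun θ => tsum_mul_left
  simp only [h1] at h
  refine h.congr_fun ?_ |>.congr_fun fun _ => rfl
  intro m
  exact (by rw [← cf_wave, ← cf_const_mul]; rfl)

lemma cf_slitFn_of_neg {a : ℤ} (ha : a < 0) : cf slitFn a = 0 := by
  refine (hasSum_cf_slitFn a).unique ?_
  convert hasSum_zero using 2 with m
  rw [if_neg (by omega), mul_zero]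

lemma cf_slitFn_mem (a : ℤ) : cf slitFn a ∈ Q2 := by
  by_cases h : ∃ m : ℕ, a = 2 * m
  · obtain ⟨m, rfl⟩ := h
    have h1 := hasSum_single (f := fun n : ℕ => (rootCoeff n : ℂ) *
      if (2 * m : ℤ) = 2 * n then 1 else 0) m (fun n hn => by
        rw [if_neg (by omega), mul_zero])
    rw [(hasSum_cf_slitFn _).unique h1]
    simpa using ratCast_mem_Q2 _
  · rw [(hasSum_cf_slitFn a).unique (by
      convert hasSum_zero using 2 with m
      rw [if_neg fun hm => h ⟨m, hm⟩, mul_zero])]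
    exact zero_mem _

lemma cf_slitFn_zero : cf slitFn 0 = 1 := by
  have h1 := hasSum_single (f := fun n : ℕ => (rootCoeff n : ℂ) *
      if (0 : ℤ) = 2 * n then 1 else 0) 0 (fun n hn => by
        rw [if_neg (by omega), mul_zero])
  rw [(hasSum_cf_slitFn _).unique h1]
  simp [rootCoeff]

lemma plusType_slitFn : PlusType slitFn :=
  ⟨⟨integrable_of_continuous continuous_slitFn, cf_slitFn_mem⟩, 0, fun _ => cf_slitFn_of_neg⟩

/-- The function `|sin θ|`, with complex values. -/
noncomputable def absSin (θ : ℝ) : ℂ := (|Real.sin θ| : ℝ)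

lemma continuous_absSin : Continuous absSin := by unfold absSin; fun_prop

lemma norm_slitFn_sq (θ : ℝ) : ‖slitFn θ‖ ^ 2 = 2 * |Real.sin θ| := by
  have h := congrFun slitFn_sq θ
  have h2 : (1 - wave 2) θ = -(2 * Complex.I * (Real.sin θ : ℝ) * wave 1 θ) := by
    have e : wave 2 θ = wave 1 θ * wave 1 θ := congrFun (wave_add 1 1) θ
    have e1 : wave 1 θ = Complex.cos θ + Complex.sin θ * Complex.I := by
      rw [wave, Int.cast_one, one_mul, Complex.exp_mul_I]
    simp only [Pi.sub_apply, Pi.one_apply, e, e1, Complex.ofReal_sin]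
    linear_combination -Complex.sin_sq_add_cos_sq (θ : ℂ) + Complex.sin θ ^ 2 * Complex.I_sq
  rw [← norm_pow, ← Pi.pow_apply, h, h2]
  simp only [norm_neg, norm_mul, norm_wave, Complex.norm_I, Complex.norm_real, Real.norm_eq_abs,
    RCLike.norm_ofNat, mul_one]

lemma star_slitFn_mul : star slitFn * slitFn = 2 * absSin := by
  funext θ
  have h := Complex.conj_mul' (slitFn θ)
  have h2 := norm_slitFn_sq θ
  simp only [Pi.mul_apply, Pi.star_apply, absSin]
  rw [← Complex.ofReal_pow, h2] at h
  rw [RCLike.star_def, h]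
  simp

lemma ae_sin_ne_zero : ∀ᵐ θ ∂circ, Real.sin θ ≠ 0 := by
  have h : (Set.range fun n : ℤ => (n : ℝ) * Real.pi).Countable := Set.countable_range _
  exact ae_restrict_of_ae ((h.ae_notMem volume).mono fun θ hθ h0 =>
    hθ (Real.sin_eq_zero_iff.1 h0))

lemma ae_cos_ne_zero : ∀ᵐ θ ∂circ, Real.cos θ ≠ 0 := by
  have h : (Set.range fun n : ℤ => (2 * n + 1 : ℝ) * Real.pi / 2).Countable :=
    Set.countable_range _
  refine ae_restrict_of_ae ((h.ae_notMem volume).mono fun θ hθ h0 => hθ ?_)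
  obtain ⟨n, hn⟩ := Real.cos_eq_zero_iff.1 h0
  exact ⟨n, hn.symm⟩

lemma slitFn_ne_zero {θ : ℝ} (hθ : Real.sin θ ≠ 0) : slitFn θ ≠ 0 := by
  intro h0
  have h := norm_slitFn_sq θ
  rw [h0] at h
  simp at h
  exact hθ h

lemma integrable_inv_slitFn : Integrable slitFn⁻¹ circ := by
  have hpi := Real.pi_pos
  have hab : -Real.pi ≤ Real.pi := by linarith
  have on : ∀ f : ℝ → ℝ, IntervalIntegrable f volume (-Real.pi) Real.pi → Integrable f circ :=
    fun f hf => (intervalIntegrable_iff_integrableOn_Ioc_of_le hab).1 hf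
  have h1 : Integrable (fun x : ℝ => x ^ (-(1 / 2) : ℝ)) circ :=
    on _ (intervalIntegral.intervalIntegrable_rpow' (by norm_num))
  have h2 : Integrable (fun x : ℝ => (0 - x) ^ (-(1 / 2) : ℝ)) circ := on _ (by
    have := (intervalIntegral.intervalIntegrable_rpow'
      (r := -(1 / 2)) (a := Real.pi) (b := -Real.pi) (by norm_num)).comp_sub_left 0
    simpa using this)
  have h3 : Integrable (fun x : ℝ => (Real.pi - x) ^ (-(1 / 2) : ℝ)) circ := on _ (by
    have := (intervalIntegral.intervalIntegrable_rpow'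
      (r := -(1 / 2)) (a := 2 * Real.pi) (b := 0) (by norm_num)).comp_sub_left Real.pi
    convert this using 1 <;> ring)
  have h4 : Integrable (fun x : ℝ => (x + Real.pi) ^ (-(1 / 2) : ℝ)) circ := on _ (by
    have := (intervalIntegral.intervalIntegrable_rpow'
      (r := -(1 / 2)) (a := 0) (b := 2 * Real.pi) (by norm_num)).comp_add_right Real.pi
    convert this using 1 <;> ring)
  refine (((h1.add h2).add h3).add h4).mono'
    continuous_slitFn.measurable.inv.aestronglyMeasurable ?_
  have nonneg : ∀ x : ℝ, 0 ≤ x ^ (-(1 / 2) : ℝ) := fun x => by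
    rcases le_or_gt 0 x with hx | hx
    · exact Real.rpow_nonneg hx _
    · rw [Real.rpow_def_of_neg hx, show -(1 / 2) * Real.pi = -(Real.pi / 2) by ring, Real.cos_neg,
        Real.cos_pi_div_two, mul_zero]
  have key : ∀ θ t : ℝ, 0 < t → t ≤ Real.pi / 2 → |Real.sin θ| = Real.sin t →
      ‖(slitFn θ)⁻¹‖ ≤ t ^ (-(1 / 2) : ℝ) := by
    intro θ t ht ht2 hs
    have h5 := Real.mul_le_sin ht.le ht2
    have h6 : t ≤ ‖slitFn θ‖ ^ 2 := by
      rw [norm_slitFn_sq, hs]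
      have h7 : 1 / 2 ≤ 2 / Real.pi := by
        rw [div_le_div_iff₀ (by norm_num) hpi]
        linarith [Real.pi_le_four]
      linarith [mul_le_mul_of_nonneg_right h7 ht.le]
    rw [norm_inv, Real.rpow_neg ht.le, ← Real.sqrt_eq_rpow]
    exact inv_anti₀ (Real.sqrt_pos.2 ht) ((Real.sqrt_le_left (norm_nonneg _)).2 h6)
  rw [circ, ae_restrict_iff' measurableSet_Ioc]
  refine Eventually.of_forall fun θ hθ => ?_
  have n1 := nonneg θ
  have n2 := nonneg (0 - θ)
  have n3 := nonneg (Real.pi - θ)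
  have n4 := nonneg (θ + Real.pi)
  simp only [Pi.inv_apply, Pi.add_apply]
  by_cases h0 : Real.sin θ = 0
  · have : slitFn θ = 0 := by
      have h := norm_slitFn_sq θ
      rw [h0] at h
      simpa using h
    rw [this, inv_zero, norm_zero]
    positivity
  rcases lt_trichotomy θ 0 with hneg | rfl | hpos
  · rcases le_or_gt θ (-(Real.pi / 2)) with h | h
    · have := key θ (θ + Real.pi) (by linarith [hθ.1]) (by linarith) (by
        rw [Real.sin_add_pi,
          abs_of_nonpos (Real.sin_nonpos_of_nonpos_of_neg_pi_le hneg.le hθ.1.le)])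
      linarith
    · have := key θ (0 - θ) (by linarith) (by linarith) (by
        rw [zero_sub, Real.sin_neg,
          abs_of_nonpos (Real.sin_nonpos_of_nonpos_of_neg_pi_le hneg.le hθ.1.le)])
      linarith
  · simp at h0
  · have habs := abs_of_nonneg (Real.sin_nonneg_of_nonneg_of_le_pi hpos.le hθ.2)
    rcases le_or_gt θ (Real.pi / 2) with h | h
    · have := key θ θ hpos h habs
      linarith
    · have hne : θ ≠ Real.pi := by rintro rfl; simp at h0
      have := key θ (Real.pi - θ) (by linarith [lt_of_le_of_ne hθ.2 hne]) (by linarith) (by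
        rw [Real.sin_pi_sub, habs])
      linarith

lemma one_sub_wave_two_mul_inv_slitFn : (1 - wave 2) * slitFn⁻¹ = slitFn := by
  rw [← slitFn_sq]
  funext θ
  by_cases h : slitFn θ = 0
  · simp [h]
  · simp only [Pi.mul_apply, Pi.pow_apply, Pi.inv_apply]; field_simp

lemma plusType_inv_slitFn : PlusType slitFn⁻¹ :=
  PlusType.of_one_sub_wave_two_mul integrable_inv_slitFn
    (by rw [one_sub_wave_two_mul_inv_slitFn]; exact plusType_slitFn)

lemma cf_inv_slitFn_rec (a : ℤ) :
    cf slitFn⁻¹ a = cf slitFn⁻¹ (a - 2) + cf slitFn a := by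
  have h : cf ((1 - wave 2) * slitFn⁻¹) a = cf slitFn a := by
    rw [one_sub_wave_two_mul_inv_slitFn]
  rw [sub_mul, one_mul, cf_sub integrable_inv_slitFn
    (integrable_wave_mul integrable_inv_slitFn _), cf_wave_mul] at h
  linear_combination h

lemma cf_inv_slitFn_of_neg {a : ℤ} (ha : a < 0) : cf slitFn⁻¹ a = 0 := by
  obtain ⟨A, hA⟩ := plusType_inv_slitFn.2
  have h : ∀ n : ℕ, ∀ b < A + n, b < 0 → cf slitFn⁻¹ b = 0 := by
    intro n
    induction n with
    | zero => intro b hb _; exact hA b (by simpa using hb)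
    | succ n ih =>
      intro b hb hb0
      rw [cf_inv_slitFn_rec, cf_slitFn_of_neg hb0, ih _ (by push_cast at hb; omega) (by omega),
        add_zero]
  exact h (a - A + 1).toNat a (by omega) ha

lemma cf_inv_slitFn_zero : cf slitFn⁻¹ 0 = 1 := by
  rw [cf_inv_slitFn_rec, cf_inv_slitFn_of_neg (by norm_num), cf_slitFn_zero, zero_add]

/-- The decay factor `cos θ / (1 + |sin θ|)`. -/
noncomputable def zFn (θ : ℝ) : ℂ := (Real.cos θ / (1 + |Real.sin θ|) : ℝ)

lemma one_add_abs_sin_pos (θ : ℝ) : 0 < 1 + |Real.sin θ| := by positivity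

lemma continuous_zFn : Continuous zFn :=
  Complex.continuous_ofReal.comp
    (Real.continuous_cos.div (by fun_prop) fun θ => (one_add_abs_sin_pos θ).ne')

lemma absSin_sq (θ : ℝ) : absSin θ ^ 2 = 1 - cosFn θ ^ 2 := by
  simp only [absSin, cosFn]
  norm_cast
  rw [sq_abs, Real.sin_sq]

lemma one_add_absSin_ne_zero (θ : ℝ) : 1 + absSin θ ≠ 0 := by
  have h := (one_add_abs_sin_pos θ).ne'
  rw [absSin]
  exact_mod_cast h

lemma zFn_mul_one_add_absSin (θ : ℝ) : zFn θ * (1 + absSin θ) = cosFn θ := by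
  have h := one_add_absSin_ne_zero θ
  rw [zFn, Complex.ofReal_div, Complex.ofReal_add, Complex.ofReal_one]
  exact div_mul_cancel₀ _ h

lemma cosFn_mul_zFn (θ : ℝ) : cosFn θ * zFn θ = 1 - absSin θ := by
  refine mul_right_cancel₀ (one_add_absSin_ne_zero θ) ?_
  rw [mul_assoc, zFn_mul_one_add_absSin]
  linear_combination absSin_sq θ

lemma one_add_zFn_sq_mul (θ : ℝ) : (1 + zFn θ ^ 2) * (1 + absSin θ) = 2 := by
  linear_combination zFn θ * zFn_mul_one_add_absSin θ + cosFn_mul_zFn θ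

lemma cosFn_mul_one_add_zFn_sq (θ : ℝ) : cosFn θ * (1 + zFn θ ^ 2) = 2 * zFn θ := by
  rw [← zFn_mul_one_add_absSin, mul_assoc, mul_comm (1 + absSin θ), one_add_zFn_sq_mul, mul_comm]

lemma norm_zFn (θ : ℝ) : ‖zFn θ‖ = |Real.cos θ| / (1 + |Real.sin θ|) := by
  rw [zFn, Complex.norm_real, Real.norm_eq_abs, abs_div, abs_of_pos (one_add_abs_sin_pos θ)]

lemma norm_zFn_le_one (θ : ℝ) : ‖zFn θ‖ ≤ 1 := by
  rw [norm_zFn, div_le_one (one_add_abs_sin_pos θ)]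
  linarith [Real.abs_cos_le_one θ, abs_nonneg (Real.sin θ)]

lemma norm_zFn_lt_one {θ : ℝ} (hθ : Real.sin θ ≠ 0) : ‖zFn θ‖ < 1 := by
  rw [norm_zFn, div_lt_one (one_add_abs_sin_pos θ)]
  linarith [Real.abs_cos_le_one θ, abs_pos.2 hθ]

lemma cosFn_ne_zero {θ : ℝ} (hθ : Real.cos θ ≠ 0) : cosFn θ ≠ 0 :=
  Complex.ofReal_ne_zero.2 hθ

lemma star_cosFn : star cosFn = cosFn := by
  funext θ
  rw [Pi.star_apply, cosFn, RCLike.star_def, Complex.conj_ofReal]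

lemma norm_cosFn_le_one (θ : ℝ) : ‖cosFn θ‖ ≤ 1 := by
  rw [cosFn, Complex.norm_real]; exact Real.abs_cos_le_one θ

/-- The polynomials in `cos θ` equal to `(1 + |sin θ|) ^ m + (1 - |sin θ|) ^ m`. -/
noncomputable def sumPoly : ℕ → ℝ → ℂ
  | 0 => 2
  | 1 => 2
  | m + 2 => 2 * sumPoly (m + 1) - cosFn ^ 2 * sumPoly m

/-- The polynomials in `cos θ` equal to
`((1 + |sin θ|) ^ m - (1 - |sin θ|) ^ m) / |sin θ|`. -/
noncomputable def diffPoly : ℕ → ℝ → ℂ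
  | 0 => 0
  | 1 => 2
  | m + 2 => 2 * diffPoly (m + 1) - cosFn ^ 2 * diffPoly m

lemma sumPoly_mem_trigPoly : ∀ m, sumPoly m ∈ trigPoly
  | 0 => ofNat_mem _ 2
  | 1 => ofNat_mem _ 2
  | m + 2 => sub_mem (mul_mem (ofNat_mem _ 2) (sumPoly_mem_trigPoly (m + 1)))
      (mul_mem (pow_mem cosFn_mem_trigPoly 2) (sumPoly_mem_trigPoly m))

lemma diffPoly_mem_trigPoly : ∀ m, diffPoly m ∈ trigPoly
  | 0 => zero_mem _
  | 1 => ofNat_mem _ 2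
  | m + 2 => sub_mem (mul_mem (ofNat_mem _ 2) (diffPoly_mem_trigPoly (m + 1)))
      (mul_mem (pow_mem cosFn_mem_trigPoly 2) (diffPoly_mem_trigPoly m))

lemma star_sumPoly : ∀ m, star (sumPoly m) = sumPoly m
  | 0 => star_ofNat 2
  | 1 => star_ofNat 2
  | m + 2 => by
    rw [sumPoly, star_sub, star_mul', star_mul', star_pow, star_cosFn, star_ofNat, star_sumPoly m,
      star_sumPoly (m + 1)]

lemma star_diffPoly : ∀ m, star (diffPoly m) = diffPoly m
  | 0 => star_zero _
  | 1 => star_ofNat 2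
  | m + 2 => by
    rw [diffPoly, star_sub, star_mul', star_mul', star_pow, star_cosFn, star_ofNat,
      star_diffPoly m, star_diffPoly (m + 1)]

lemma two_mul_cosFn_mul_zFn_pow (θ : ℝ) :
    ∀ m, 2 * (cosFn θ * zFn θ) ^ m = sumPoly m θ - absSin θ * diffPoly m θ
  | 0 => by simp [sumPoly, diffPoly]
  | 1 => by simp [sumPoly, diffPoly, cosFn_mul_zFn]; ring
  | m + 2 => by
    have h0 := two_mul_cosFn_mul_zFn_pow θ m
    have h1 := two_mul_cosFn_mul_zFn_pow θ (m + 1)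
    have h2 := absSin_sq θ
    simp only [sumPoly, diffPoly, Pi.sub_apply, Pi.mul_apply, Pi.pow_apply, Pi.ofNat_apply]
    rw [cosFn_mul_zFn] at h0 h1 ⊢
    linear_combination 2 * h1 - cosFn θ ^ 2 * h0 + 2 * (1 - absSin θ) ^ m * h2

lemma exists_norm_le_of_mem_trigPoly {m : ℝ → ℂ} (hm : m ∈ trigPoly) :
    ∃ c, 0 ≤ c ∧ ∀ θ, ‖m θ‖ ≤ c := by
  refine Subring.closure_induction (p := fun m _ => ∃ c, 0 ≤ c ∧ ∀ θ, ‖m θ‖ ≤ c)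
    ?_ ?_ ?_ ?_ ?_ ?_ hm
  · rintro x (⟨c, hc, rfl⟩ | rfl | rfl)
    · exact ⟨‖c‖, norm_nonneg _, fun _ => le_rfl⟩
    · exact ⟨1, zero_le_one, fun θ => (norm_wave _ θ).le⟩
    · exact ⟨1, zero_le_one, fun θ => (norm_wave _ θ).le⟩
  · exact ⟨0, le_rfl, fun θ => by simp⟩
  · exact ⟨1, zero_le_one, fun θ => by simp⟩
  · rintro x y _ _ ⟨c, hc, hx⟩ ⟨d, hd, hy⟩
    exact ⟨c + d, by positivity, fun θ => (norm_add_le _ _).trans (add_le_add (hx θ) (hy θ))⟩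
  · rintro x _ ⟨c, hc, hx⟩
    exact ⟨c, hc, fun θ => by simpa using hx θ⟩
  · rintro x y _ _ ⟨c, hc, hx⟩ ⟨d, hd, hy⟩
    exact ⟨c * d, by positivity, fun θ => by
      rw [Pi.mul_apply, norm_mul]; exact mul_le_mul (hx θ) (hy θ) (norm_nonneg _) hc⟩

lemma star_slitFn_sq (θ : ℝ) : star (slitFn θ) ^ 2 = 1 - wave (-2) θ := by
  have h := congrFun (congrArg star slitFn_sq) θ
  rw [star_pow, star_sub, star_one, star_wave] at h
  exact h

lemma norm_one_add_wave_neg_two (θ : ℝ) : ‖1 + wave (-2) θ‖ = 2 * ‖cosFn θ‖ := by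
  have e : wave (-1) θ * (2 * cosFn) θ = 1 + wave (-2) θ := by
    rw [two_mul_cosFn, Pi.add_apply, mul_add, ← Pi.mul_apply, ← Pi.mul_apply, ← wave_add,
      ← wave_add]
    norm_num [wave_zero]
  rw [← e, norm_mul, norm_wave, one_mul, Pi.mul_apply, norm_mul]
  simp

/-- There are Laurent polynomials approximating `2 / conj (slitFn)` to any order at the zeros of
the cosine. -/
lemma exists_trigPoly_approx_two_pow (k : ℕ) : ∃ t ∈ trigPoly, ∃ c : ℝ, 0 ≤ c ∧
    ∀ θ, ‖t θ * star (slitFn θ) / 2 - 1‖ ≤ c * ‖cosFn θ‖ ^ (2 ^ k) := by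
  induction k with
  | zero =>
    refine ⟨fun _ => (Real.sqrt 2 : ℝ), const_mem_trigPoly sqrt_two_mem_Q2, 1, zero_le_one,
      fun θ => ?_⟩
    set u : ℂ := (Real.sqrt 2 : ℝ) * star (slitFn θ) / 2 with hu
    have hsqrt : ((Real.sqrt 2 : ℝ) : ℂ) ^ 2 = 2 := by
      rw [← Complex.ofReal_pow, Real.sq_sqrt (by norm_num)]; norm_num
    have h1 : (u - 1) * (u + 1) = -(1 + wave (-2) θ) / 2 := by
      have h := star_slitFn_sq θ
      rw [hu]
      linear_combination (star (slitFn θ)) ^ 2 / 4 * hsqrt + h / 2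
    have h2 : ‖u - 1‖ * ‖u + 1‖ = ‖cosFn θ‖ := by
      rw [← norm_mul, h1, norm_div, norm_neg, norm_one_add_wave_neg_two]; simp
    have h3 : 1 ≤ ‖u + 1‖ := by
      have hre : 0 ≤ u.re := by
        have : u = ((Real.sqrt 2 / 2 : ℝ) : ℂ) * star (slitFn θ) := by
          rw [hu]; push_cast; ring
        rw [this, Complex.re_ofReal_mul]
        exact mul_nonneg (by positivity) (by simpa using slitFn_re_nonneg θ)
      refine le_trans ?_ (Complex.re_le_norm _)
      rw [Complex.add_re, Complex.one_re]; linarith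
    rw [pow_zero, pow_one, one_mul, ← h2]
    exact le_mul_of_one_le_right (norm_nonneg _) h3
  | succ k ih =>
    obtain ⟨t, ht, c, hc, h⟩ := ih
    refine ⟨t * (3 - (fun _ => 2⁻¹ * 2⁻¹) * t ^ 2 * (1 - wave (-1) ^ 2)) * (fun _ => 2⁻¹), ?_,
      c ^ 2 * (c + 3) / 2, by positivity, fun θ => ?_⟩
    · have hhalf := half_mem_Q2
      exact mul_mem (mul_mem ht (sub_mem (ofNat_mem _ 3) (mul_mem (mul_mem
        (const_mem_trigPoly (mul_mem hhalf hhalf)) (pow_mem ht 2))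
        (sub_mem (one_mem _) (pow_mem wave_neg_one_mem_trigPoly 2))))) (const_mem_trigPoly hhalf)
    · have hw : (wave (-1) ^ 2) θ = wave (-2) θ := by
        rw [sq, ← wave_add]; norm_num
      set u := t θ * star (slitFn θ) / 2 with hu
      have h1 : (t * (3 - (fun _ => 2⁻¹ * 2⁻¹) * t ^ 2 * (1 - wave (-1) ^ 2)) * (fun _ => 2⁻¹) :
            ℝ → ℂ) θ
          * star (slitFn θ) / 2 - 1 = -((u - 1) ^ 2 * (u + 2) / 2) := by
        simp only [Pi.mul_apply, Pi.sub_apply, Pi.ofNat_apply, hw]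
        rw [← star_slitFn_sq, hu, Pi.pow_apply]
        ring
      have h2 : ‖u + 2‖ ≤ c + 3 := by
        have h3 : ‖u - 1‖ ≤ c := (h θ).trans
          (mul_le_of_le_one_right hc (pow_le_one₀ (norm_nonneg _) (norm_cosFn_le_one θ)))
        calc ‖u + 2‖ = ‖(u - 1) + 3‖ := by congr 1; ring
          _ ≤ ‖u - 1‖ + ‖(3 : ℂ)‖ := norm_add_le _ _
          _ ≤ c + 3 := by rw [RCLike.norm_ofNat]; linarith
      rw [h1, norm_neg, norm_div, norm_mul, norm_pow, RCLike.norm_ofNat]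
      calc ‖u - 1‖ ^ 2 * ‖u + 2‖ / 2 ≤ (c * ‖cosFn θ‖ ^ (2 ^ k)) ^ 2 * (c + 3) / 2 := by
            gcongr; exact h θ
        _ = _ := by ring

lemma exists_trigPoly_approx (n : ℕ) : ∃ t ∈ trigPoly, ∃ c : ℝ, 0 ≤ c ∧
    ∀ θ, ‖t θ * star (slitFn θ) / 2 - 1‖ ≤ c * ‖cosFn θ‖ ^ n := by
  obtain ⟨t, ht, c, hc, h⟩ := exists_trigPoly_approx_two_pow n
  refine ⟨t, ht, c, hc, fun θ => (h θ).trans ?_⟩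
  gcongr c * ?_
  exact pow_le_pow_of_le_one (norm_nonneg _) (norm_cosFn_le_one θ) Nat.lt_two_pow_self.le

lemma PlusType.of_cosFn_pow_mul_ae {φ ψ : ℝ → ℂ} (m : ℕ) (hψ : Integrable ψ circ)
    (hφ : PlusType φ) (h : ∀ θ, Real.cos θ ≠ 0 → Real.sin θ ≠ 0 → φ θ = cosFn θ ^ m * ψ θ) :
    PlusType ψ :=
  PlusType.of_cosFn_pow_mul m hψ (hφ.congr (by
    filter_upwards [ae_cos_ne_zero, ae_sin_ne_zero] with θ hc hs using h θ hc hs))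

lemma absSin_eq (θ : ℝ) :
    absSin θ = slitFn θ * star (slitFn θ) / 2 := by
  have h := congrFun star_slitFn_mul θ
  simp only [Pi.mul_apply, Pi.star_apply, Pi.ofNat_apply] at h
  linear_combination -h / 2

lemma integrable_zFn_pow_mul_inv_slitFn (m : ℕ) : Integrable (zFn ^ m * slitFn⁻¹) circ :=
  integrable_inv_slitFn.bdd_mul (c := 1) (continuous_zFn.pow m).aestronglyMeasurable
    (Eventually.of_forall fun θ => by
      rw [Pi.pow_apply, norm_pow]; exact pow_le_one₀ (norm_nonneg _) (norm_zFn_le_one θ))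

lemma measurable_cosFn : Measurable cosFn := continuous_cosFn.measurable

lemma qType_zFn_pow_mul_inv_slitFn (m : ℕ) : QType (zFn ^ m * slitFn⁻¹) := by
  obtain ⟨t, ht, c, hc, happ⟩ := exists_trigPoly_approx m
  obtain ⟨B, hB, hxB⟩ := exists_norm_le_of_mem_trigPoly (sumPoly_mem_trigPoly m)
  have htm := (continuous_of_mem_trigPoly ht).measurable
  have hhalf := const_mem_trigPoly half_mem_Q2
  set P : ℝ → ℂ := fun θ => sumPoly m θ / cosFn θ ^ m * ((slitFn θ)⁻¹ - star (t θ) / 2) / 2 with hP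
  have hPm : AEStronglyMeasurable P circ := by
    refine Measurable.aestronglyMeasurable ?_
    have h1 := (continuous_of_mem_trigPoly (sumPoly_mem_trigPoly m)).measurable
    have h2 := continuous_slitFn.measurable
    have h3 : Measurable fun θ => star (t θ) := Complex.continuous_conj.measurable.comp htm
    exact ((h1.div (measurable_cosFn.pow_const m)).mul (h2.inv.sub (h3.div_const 2))).div_const 2
  have hPi : Integrable P circ := by
    refine ((integrable_inv_slitFn.norm).const_mul (B * c)).mono' hPm ?_
    filter_upwards [ae_sin_ne_zero, ae_cos_ne_zero] with θ hs hcos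
    have hs0 := slitFn_ne_zero hs
    have hc0 := norm_pos_iff.2 (cosFn_ne_zero hcos)
    have h1 : (slitFn θ)⁻¹ - star (t θ) / 2 =
        -star (t θ * star (slitFn θ) / 2 - 1) * (slitFn θ)⁻¹ := by
      simp only [star_sub, star_mul', star_div₀, star_star, star_one, star_ofNat]
      field_simp; ring
    have h2 := happ θ
    rw [hP]
    simp only [norm_div, norm_mul, norm_pow, h1, norm_neg, norm_star, RCLike.norm_ofNat,
      Pi.inv_apply]
    calc _ ≤ B / ‖cosFn θ‖ ^ m * (c * ‖cosFn θ‖ ^ m * ‖(slitFn θ)⁻¹‖) / 2 := by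
          gcongr; exact hxB θ
      _ = B * c * ‖(slitFn θ)⁻¹‖ / 2 := by field_simp
      _ ≤ B * c * ‖(slitFn θ)⁻¹‖ := half_le_self (by positivity)
  have hPP : PlusType P := by
    refine PlusType.of_cosFn_pow_mul_ae m hPi ((plusType_inv_slitFn.sub (plusType_of_mem_trigPoly
      (mul_mem (star_mem_trigPoly ht) hhalf))).trigPoly_mul
      (mul_mem (sumPoly_mem_trigPoly m) hhalf)) fun θ hcos _ => ?_
    have hc0 := cosFn_ne_zero hcos
    rw [hP]
    simp only [Pi.mul_apply, Pi.sub_apply, Pi.inv_apply, Pi.star_apply]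
    field_simp
  have hR : PlusType (star (zFn ^ m * slitFn⁻¹ - P)) := by
    refine PlusType.of_cosFn_pow_mul_ae m
      (integrable_star ((integrable_zFn_pow_mul_inv_slitFn m).sub hPi))
      (((plusType_of_mem_trigPoly (mul_mem (mul_mem (sumPoly_mem_trigPoly m) ht)
        (mul_mem hhalf hhalf)))).sub (plusType_slitFn.trigPoly_mul
        (mul_mem (diffPoly_mem_trigPoly m) (mul_mem hhalf hhalf)))) fun θ hcos hs => ?_
    have hc0 := cosFn_ne_zero hcos
    have hs0 := slitFn_ne_zero hs
    have h1 := two_mul_cosFn_mul_zFn_pow θ m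
    rw [absSin_eq, mul_pow] at h1
    have h2 : cosFn θ ^ m * (zFn ^ m * slitFn⁻¹ - P) θ =
        (sumPoly m * star t * (fun _ => 4⁻¹) - diffPoly m * (fun _ => 4⁻¹) * star slitFn :
          ℝ → ℂ) θ := by
      rw [hP]
      simp only [Pi.mul_apply, Pi.sub_apply, Pi.inv_apply, Pi.star_apply, Pi.pow_apply]
      field_simp
      linear_combination 8 * h1
    have h3 := congrArg star h2
    have h4 : star (cosFn θ) = cosFn θ := congrFun star_cosFn θ
    have h5 : star (sumPoly m θ) = sumPoly m θ := congrFun (star_sumPoly m) θ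
    have h6 : star (diffPoly m θ) = diffPoly m θ := congrFun (star_diffPoly m) θ
    rw [star_mul', star_pow, h4] at h3
    rw [Pi.star_apply, h3]
    simp only [Pi.mul_apply, Pi.sub_apply, Pi.star_apply, star_sub, star_mul', star_star, h5, h6,
      star_inv₀, star_ofNat]
    ring
  have h := hPP.1.add hR.1.star
  rwa [star_star, add_sub_cancel] at h

/-- The part of the row functions of the seed solutions that compensates the slit. -/
noncomputable def corrFn (t : ℝ → ℂ) (m : ℕ) (θ : ℝ) : ℂ :=
  diffPoly m θ / cosFn θ ^ m * (t θ * star (slitFn θ) / 2 - 1)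

lemma corrFn_zero (t : ℝ → ℂ) : corrFn t 0 = 0 := by
  funext θ; simp [corrFn, diffPoly]

lemma corrFn_rec (t : ℝ → ℂ) (m : ℕ) {θ : ℝ} (hθ : Real.cos θ ≠ 0) :
    4 * corrFn t (m + 1) θ - 2 * cosFn θ * (corrFn t m θ + corrFn t (m + 2) θ) = 0 := by
  have hc0 := cosFn_ne_zero hθ
  simp only [corrFn, diffPoly, Pi.sub_apply, Pi.mul_apply, Pi.pow_apply, Pi.ofNat_apply]
  field_simp
  ring

section seeds

variable {t : ℝ → ℂ} {c : ℝ} {n : ℕ}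

lemma integrable_corrFn (ht : t ∈ trigPoly)
    (happ : ∀ θ, ‖t θ * star (slitFn θ) / 2 - 1‖ ≤ c * ‖cosFn θ‖ ^ n) (hc : 0 ≤ c)
    {m : ℕ} (hm : m ≤ n) : Integrable (corrFn t m) circ := by
  obtain ⟨B, hB, hxB⟩ := exists_norm_le_of_mem_trigPoly (diffPoly_mem_trigPoly m)
  have hmeas : AEStronglyMeasurable (corrFn t m) circ := by
    refine Measurable.aestronglyMeasurable ?_
    have h1 := (continuous_of_mem_trigPoly (diffPoly_mem_trigPoly m)).measurable
    have h2 := (continuous_of_mem_trigPoly ht).measurable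
    have h3 : Measurable fun θ => star (slitFn θ) :=
      Complex.continuous_conj.measurable.comp continuous_slitFn.measurable
    exact (h1.div (measurable_cosFn.pow_const m)).mul (((h2.mul h3).div_const 2).sub_const 1)
  refine (integrable_const (B * c)).mono' hmeas ?_
  filter_upwards [ae_cos_ne_zero] with θ hcos
  have hc0 := norm_pos_iff.2 (cosFn_ne_zero hcos)
  have h2 := (happ θ).trans (mul_le_mul_of_nonneg_left
    (pow_le_pow_of_le_one (norm_nonneg _) (norm_cosFn_le_one θ) hm) hc)
  rw [corrFn, norm_mul, norm_div, norm_pow]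
  calc _ ≤ B / ‖cosFn θ‖ ^ m * (c * ‖cosFn θ‖ ^ m) := by gcongr; exact hxB θ
    _ = B * c := by field_simp

lemma plusType_star_corrFn (ht : t ∈ trigPoly)
    (happ : ∀ θ, ‖t θ * star (slitFn θ) / 2 - 1‖ ≤ c * ‖cosFn θ‖ ^ n) (hc : 0 ≤ c)
    {m : ℕ} (hm : m ≤ n) : PlusType (star (corrFn t m)) := by
  have hhalf := const_mem_trigPoly half_mem_Q2
  refine PlusType.of_cosFn_pow_mul_ae m (integrable_star (integrable_corrFn ht happ hc hm))
    (((plusType_slitFn.trigPoly_mul (mul_mem (star_mem_trigPoly ht) hhalf)).sub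
      PlusType.one).trigPoly_mul (diffPoly_mem_trigPoly m)) fun θ hcos _ => ?_
  have hc0 := cosFn_ne_zero hcos
  have h4 : star (cosFn θ) = cosFn θ := congrFun star_cosFn θ
  have h6 : star (diffPoly m θ) = diffPoly m θ := congrFun (star_diffPoly m) θ
  simp only [corrFn, Pi.mul_apply, Pi.sub_apply, Pi.star_apply, star_sub, star_mul', star_div₀,
    star_star, h4, h6, star_ofNat, star_one, star_pow, Pi.one_apply]
  field_simp

lemma qType_corrFn (ht : t ∈ trigPoly)
    (happ : ∀ θ, ‖t θ * star (slitFn θ) / 2 - 1‖ ≤ c * ‖cosFn θ‖ ^ n) (hc : 0 ≤ c)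
    {m : ℕ} (hm : m ≤ n) : QType (corrFn t m) := by
  simpa using (plusType_star_corrFn ht happ hc hm).1.star

lemma plusType_seed_row (ht : t ∈ trigPoly)
    (happ : ∀ θ, ‖t θ * star (slitFn θ) / 2 - 1‖ ≤ c * ‖cosFn θ‖ ^ n) (hc : 0 ≤ c) :
    PlusType ((zFn ^ n + zFn ^ n) * (t * slitFn⁻¹) + corrFn t n) := by
  have h1 : QType ((zFn ^ n + zFn ^ n) * (t * slitFn⁻¹) + corrFn t n) := by
    refine QType.add ?_ (qType_corrFn ht happ hc le_rfl)
    rw [mul_left_comm, add_mul]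
    exact ((qType_zFn_pow_mul_inv_slitFn n).add (qType_zFn_pow_mul_inv_slitFn n)).trigPoly_mul ht
  refine PlusType.of_cosFn_pow_mul_ae n h1.1
    ((plusType_inv_slitFn.trigPoly_mul (mul_mem (sumPoly_mem_trigPoly n) ht)).sub
      (plusType_of_mem_trigPoly (diffPoly_mem_trigPoly n))) fun θ hcos hs => ?_
  have hc0 := cosFn_ne_zero hcos
  have hs0 := slitFn_ne_zero hs
  have h1 := two_mul_cosFn_mul_zFn_pow θ n
  rw [absSin_eq, mul_pow] at h1
  simp only [corrFn, Pi.mul_apply, Pi.sub_apply, Pi.inv_apply, Pi.pow_apply, Pi.add_apply]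
  field_simp
  linear_combination (-2 * t θ) * h1

end seeds

/-- The lattice Laplacian in the rotated coordinates `a = x + y`, `b = x - y`. -/
def lap (H : ℤ → ℤ → ℂ) (a b : ℤ) : ℂ :=
  4 * H a b - (H (a + 1) (b + 1) + H (a - 1) (b - 1) + H (a + 1) (b - 1) + H (a - 1) (b + 1))

/-- Convergence to zero at infinity. -/
def Decays (H : ℤ → ℤ → ℂ) : Prop :=
  Tendsto (fun p : ℤ × ℤ => H p.1 p.2) cofinite (𝓝 0)

lemma lap_cf {φ : ℤ → ℝ → ℂ} (hφ : ∀ b, Integrable (φ b) circ) (a b : ℤ) :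
    lap (fun a b => cf (φ b) a) a b =
      cf (4 * φ b - 2 * cosFn * (φ (b + 1) + φ (b - 1))) a := by
  have h4 : Integrable (4 * φ b) circ := (hφ b).const_mul 4
  have hs : Integrable (φ (b + 1) + φ (b - 1)) circ := (hφ _).add (hφ _)
  have hc : Integrable (2 * cosFn * (φ (b + 1) + φ (b - 1))) circ := by
    rw [two_mul_cosFn, add_mul]
    exact (integrable_wave_mul hs _).add (integrable_wave_mul hs _)
  have e4 : cf (4 * φ b) a = 4 * cf (φ b) a := cf_const_mul 4 _ _
  rw [cf_sub h4 hc, cf_two_mul_cosFn_mul hs, cf_add (hφ _) (hφ _), cf_add (hφ _) (hφ _), e4, lap]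
  ring

lemma Decays.add {H K : ℤ → ℤ → ℂ} (hH : Decays H) (hK : Decays K) :
    Decays fun a b => H a b + K a b := by
  simpa [Decays] using Tendsto.add hH hK

lemma Decays.const_mul {H : ℤ → ℤ → ℂ} (hH : Decays H) (c : ℂ) : Decays fun a b => c * H a b := by
  simpa [Decays] using Tendsto.const_mul c hH

lemma Decays.shift {H : ℤ → ℤ → ℂ} (hH : Decays H) (k l : ℤ) :
    Decays fun a b => H (a + k) (b + l) := by
  have hinj : Function.Injective fun p : ℤ × ℤ => (p.1 + k, p.2 + l) := by
    rintro ⟨a, b⟩ ⟨c, d⟩ h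
    simp only [Prod.mk.injEq] at h ⊢
    omega
  exact Tendsto.comp hH hinj.tendsto_cofinite

lemma decays_cf {φ : ℤ → ℝ → ℂ} (hφ : Tendsto (fun b => ∫ θ, ‖φ b θ‖ ∂circ) cofinite (𝓝 0)) :
    Decays fun a b => cf (φ b) a := by
  rw [Decays, Metric.tendsto_nhds]
  intro ε hε
  have hfin := (Metric.tendsto_nhds.1 hφ) ε hε
  rw [eventually_cofinite] at hfin ⊢
  have hrow : ∀ b, {a | ¬dist (cf (φ b) a) 0 < ε}.Finite := fun b =>
    eventually_cofinite.1 ((Metric.tendsto_nhds.1 (cf_tendsto_zero (φ b))) ε hε)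
  refine (hfin.biUnion fun b _ => (hrow b).prod (Set.finite_singleton b)).subset ?_
  rintro ⟨a, b⟩ hab
  simp only [Set.mem_ofPred_eq] at hab
  refine Set.mem_biUnion (x := b) ?_ ⟨hab, rfl⟩
  intro h
  refine hab (lt_of_le_of_lt ?_ h)
  rw [dist_zero_right, dist_zero_right]
  exact (norm_cf_le _ _).trans (le_abs_self _)

lemma tendsto_natAbs_cofinite : Tendsto Int.natAbs cofinite atTop := by
  rw [← Nat.cofinite_eq_atTop]
  refine Tendsto.cofinite_of_finite_preimage_singleton fun n => ?_
  refine (Set.finite_Icc (-(n : ℤ)) n).subset fun b hb => ?_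
  simp only [Set.mem_preimage, Set.mem_singleton_iff, Set.mem_Icc] at hb ⊢
  omega

lemma integrable_zFn_pow_mul {Φ : ℝ → ℂ} (hΦ : Integrable Φ circ) (m : ℕ) :
    Integrable (zFn ^ m * Φ) circ :=
  hΦ.bdd_mul (c := 1) (continuous_zFn.pow m).aestronglyMeasurable
    (Eventually.of_forall fun θ => by
      rw [Pi.pow_apply, norm_pow]; exact pow_le_one₀ (norm_nonneg _) (norm_zFn_le_one θ))

lemma decays_cf_zFn_pow_mul {Φ : ℝ → ℂ} (hΦ : Integrable Φ circ) {g : ℤ → ℕ}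
    (hg : Tendsto g cofinite atTop) : Decays fun a b => cf (zFn ^ g b * Φ) a := by
  refine decays_cf ?_
  have h : Tendsto (fun m : ℕ => ∫ θ, ‖(zFn ^ m * Φ) θ‖ ∂circ) atTop (𝓝 (∫ _, (0 : ℝ) ∂circ)) := by
    refine tendsto_integral_of_dominated_convergence (fun θ => ‖Φ θ‖)
      (fun m => (integrable_zFn_pow_mul hΦ m).1.norm) hΦ.norm (fun m => ?_) ?_
    · refine Eventually.of_forall fun θ => ?_
      rw [norm_norm, Pi.mul_apply, Pi.pow_apply, norm_mul, norm_pow]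
      exact mul_le_of_le_one_left (norm_nonneg _) (pow_le_one₀ (norm_nonneg _) (norm_zFn_le_one θ))
    · filter_upwards [ae_sin_ne_zero] with θ hθ
      simp only [Pi.mul_apply, Pi.pow_apply, norm_mul, norm_pow]
      simpa using (tendsto_pow_atTop_nhds_zero_of_lt_one (norm_nonneg _)
        (norm_zFn_lt_one hθ)).mul_const ‖Φ θ‖
  rw [integral_zero] at h
  exact h.comp hg

lemma zFn_pow_rec (j : ℤ) (θ : ℝ) :
    4 * zFn θ ^ j.natAbs - 2 * cosFn θ * (zFn θ ^ (j + 1).natAbs + zFn θ ^ (j - 1).natAbs) =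
      if j = 0 then 4 * absSin θ else 0 := by
  have h1 := cosFn_mul_zFn θ
  have h2 := cosFn_mul_one_add_zFn_sq θ
  split_ifs with hj
  · subst hj
    norm_num
    linear_combination -4 * h1
  · obtain ⟨k, hk⟩ : ∃ k : ℕ, j = k + 1 ∨ j = -(k + 1) :=
      ⟨j.natAbs - 1, by omega⟩
    have e : zFn θ ^ (j + 1).natAbs + zFn θ ^ (j - 1).natAbs = zFn θ ^ (k + 2) + zFn θ ^ k := by
      rcases hk with rfl | rfl
      · rw [show ((k : ℤ) + 1 + 1).natAbs = k + 2 by omega,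
          show ((k : ℤ) + 1 - 1).natAbs = k by omega]
      · rw [show (-((k : ℤ) + 1) + 1).natAbs = k by omega,
          show (-((k : ℤ) + 1) - 1).natAbs = k + 2 by omega, add_comm]
    rw [e, show j.natAbs = k + 1 by omega]
    linear_combination (-2 * zFn θ ^ k) * h2

/-- The function, harmonic off the slit, that vanishes on the slit except at the tip. -/
noncomputable def tip (a b : ℤ) : ℂ := cf (zFn ^ b.natAbs * slitFn⁻¹) a

lemma tip_mem (a b : ℤ) : tip a b ∈ Q2 := (qType_zFn_pow_mul_inv_slitFn _).2 a

lemma tip_of_neg {a : ℤ} (ha : a < 0) : tip a 0 = 0 := by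
  rw [tip, Int.natAbs_zero, pow_zero, one_mul, cf_inv_slitFn_of_neg ha]

lemma tip_zero : tip 0 0 = 1 := by
  rw [tip, Int.natAbs_zero, pow_zero, one_mul, cf_inv_slitFn_zero]

lemma decays_tip : Decays tip := 
  decays_cf_zFn_pow_mul integrable_inv_slitFn tendsto_natAbs_cofinite

lemma lap_tip (a b : ℤ) : lap tip a b = if b = 0 then 2 * star (cf slitFn (-a)) else 0 := by
  have h := lap_cf (φ := fun b => zFn ^ b.natAbs * slitFn⁻¹)
    (fun b => integrable_zFn_pow_mul integrable_inv_slitFn _) a b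
  refine h.trans ?_
  have e : (4 * (zFn ^ b.natAbs * slitFn⁻¹) - 2 * cosFn * (zFn ^ (b + 1).natAbs * slitFn⁻¹ +
      zFn ^ (b - 1).natAbs * slitFn⁻¹)) =
      fun θ => (if b = 0 then 4 * absSin θ else 0) * (slitFn θ)⁻¹ := by
    funext θ
    simp only [Pi.mul_apply, Pi.sub_apply, Pi.inv_apply, Pi.pow_apply, Pi.add_apply,
      Pi.ofNat_apply, ← zFn_pow_rec]
    ring
  rw [e]
  split_ifs with hb
  · rw [← cf_star, ← cf_const_mul]
    refine cf_congr ?_ a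
    filter_upwards [ae_sin_ne_zero] with θ hs
    have hs0 := slitFn_ne_zero hs
    rw [absSin_eq]
    simp only [Pi.mul_apply, Pi.star_apply]
    field_simp
    ring
  · simp [cf]

lemma lap_tip_of_pos {a : ℤ} (ha : 0 < a) : lap tip a 0 = 0 := by
  rw [lap_tip, if_pos rfl, cf_slitFn_of_neg (by omega), star_zero, mul_zero]

lemma lap_tip_zero : lap tip 0 0 = 2 := by
  rw [lap_tip, if_pos rfl, neg_zero, cf_slitFn_zero, star_one, mul_one]

lemma lap_tip_mem (a b : ℤ) : lap tip a b ∈ Q2 := by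
  rw [lap_tip]
  split_ifs
  · exact mul_mem (ofNat_mem _ 2) (star_mem_Q2 (cf_slitFn_mem _))
  · exact zero_mem _

/-- The row functions of the seed solutions. -/
noncomputable def seedRow (t : ℝ → ℂ) (n : ℕ) (b : ℤ) : ℝ → ℂ :=
  (zFn ^ (b - n).natAbs + zFn ^ (b + n).natAbs) * (t * slitFn⁻¹) + corrFn t (n - b.natAbs)

section seeds

variable {t : ℝ → ℂ} {c : ℝ} {n : ℕ}

lemma qType_seedRow (ht : t ∈ trigPoly)
    (happ : ∀ θ, ‖t θ * star (slitFn θ) / 2 - 1‖ ≤ c * ‖cosFn θ‖ ^ n) (hc : 0 ≤ c) (b : ℤ) :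
    QType (seedRow t n b) := by
  refine QType.add ?_ (qType_corrFn ht happ hc (Nat.sub_le _ _))
  rw [mul_left_comm, add_mul]
  exact ((qType_zFn_pow_mul_inv_slitFn _).add (qType_zFn_pow_mul_inv_slitFn _)).trigPoly_mul ht

lemma decays_seedRow (ht : t ∈ trigPoly)
    (happ : ∀ θ, ‖t θ * star (slitFn θ) / 2 - 1‖ ≤ c * ‖cosFn θ‖ ^ n) (hc : 0 ≤ c) :
    Decays fun a b => cf (seedRow t n b) a := by
  have hΦ : Integrable (t * slitFn⁻¹) circ :=
    (plusType_inv_slitFn.1.trigPoly_mul ht).1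
  have hz := decays_cf_zFn_pow_mul hΦ tendsto_natAbs_cofinite
  have hw : Decays fun a b => cf (corrFn t (n - b.natAbs)) a := by
    refine decays_cf (tendsto_const_nhds.congr' ?_)
    filter_upwards [tendsto_natAbs_cofinite.eventually_ge_atTop n] with b hb
    rw [Nat.sub_eq_zero_of_le hb, corrFn_zero]
    simp
  have h := ((hz.shift 0 (-n)).add (hz.shift 0 n)).add hw
  refine h.congr fun p => ?_
  dsimp only
  rw [seedRow, cf_add _ (qType_corrFn ht happ hc (Nat.sub_le _ _)).1, add_mul,
    cf_add (integrable_zFn_pow_mul hΦ _) (integrable_zFn_pow_mul hΦ _), add_zero, sub_eq_add_neg]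
  rw [add_mul]
  exact (integrable_zFn_pow_mul hΦ _).add (integrable_zFn_pow_mul hΦ _)

lemma seedRow_rec (b : ℤ) (θ : ℝ) :
    (4 * seedRow t n b - 2 * cosFn * (seedRow t n (b + 1) + seedRow t n (b - 1))) θ =
      ((if b - n = 0 then 4 * absSin θ else 0) + (if b + n = 0 then 4 * absSin θ else 0)) *
        (t θ * (slitFn θ)⁻¹) + (4 * corrFn t (n - b.natAbs) θ - 2 * cosFn θ *
        (corrFn t (n - (b + 1).natAbs) θ + corrFn t (n - (b - 1).natAbs) θ)) := by
  rw [← zFn_pow_rec, ← zFn_pow_rec]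
  simp only [seedRow, Pi.mul_apply, Pi.sub_apply, Pi.inv_apply, Pi.pow_apply, Pi.add_apply,
    Pi.ofNat_apply, show b + 1 - (n : ℤ) = b - n + 1 by ring,
    show b + 1 + (n : ℤ) = b + n + 1 by ring, show b - 1 - (n : ℤ) = b - n - 1 by ring,
    show b - 1 + (n : ℤ) = b + n - 1 by ring]
  ring

lemma lap_seedRow (ht : t ∈ trigPoly)
    (happ : ∀ θ, ‖t θ * star (slitFn θ) / 2 - 1‖ ≤ c * ‖cosFn θ‖ ^ n) (hc : 0 ≤ c) (a b : ℤ) :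
    lap (fun a b => cf (seedRow t n b) a) a b =
      cf (4 * seedRow t n b - 2 * cosFn * (seedRow t n (b + 1) + seedRow t n (b - 1))) a :=
  lap_cf (fun b => (qType_seedRow ht happ hc b).1) a b

lemma lap_seedRow_of_ne_zero (ht : t ∈ trigPoly)
    (happ : ∀ θ, ‖t θ * star (slitFn θ) / 2 - 1‖ ≤ c * ‖cosFn θ‖ ^ n) (hc : 0 ≤ c)
    (a : ℤ) {b : ℤ} (hb : b ≠ 0) :
    lap (fun a b => cf (seedRow t n b) a) a b = if a = 0 ∧ b.natAbs = n then 4 else 0 := by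
  rw [lap_seedRow ht happ hc]
  have key : (4 * seedRow t n b - 2 * cosFn * (seedRow t n (b + 1) + seedRow t n (b - 1)))
      =ᵐ[circ] (fun _ => if b.natAbs = n then 4 else 0) * wave 0 := by
    filter_upwards [ae_sin_ne_zero, ae_cos_ne_zero] with θ hs hcos
    have hs0 := slitFn_ne_zero hs
    have hc0 := cosFn_ne_zero hcos
    rw [seedRow_rec, wave_zero, mul_one]
    rcases lt_trichotomy b.natAbs n with h | h | h
    · obtain ⟨m, hm⟩ : ∃ m, n - b.natAbs = m + 1 := ⟨n - b.natAbs - 1, by omega⟩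
      have e : corrFn t (n - (b + 1).natAbs) θ + corrFn t (n - (b - 1).natAbs) θ =
          corrFn t m θ + corrFn t (m + 2) θ := by
        rcases lt_or_gt_of_ne hb with h0 | h0
        · rw [add_comm, show n - (b - 1).natAbs = m by omega,
            show n - (b + 1).natAbs = m + 2 by omega]
        · rw [show n - (b - 1).natAbs = m + 2 by omega, show n - (b + 1).natAbs = m by omega]
      rw [if_neg (by omega), if_neg (by omega), if_neg (by omega), hm, e, corrFn_rec t m hcos]
      simp
    · have e : corrFn t (n - (b + 1).natAbs) θ + corrFn t (n - (b - 1).natAbs) θ =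
          corrFn t 0 θ + corrFn t 1 θ := by
        rcases lt_or_gt_of_ne hb with h0 | h0
        · rw [add_comm, show n - (b - 1).natAbs = 0 by omega,
            show n - (b + 1).natAbs = 1 by omega]
        · rw [show n - (b - 1).natAbs = 1 by omega, show n - (b + 1).natAbs = 0 by omega]
      have e2 : ((if b - n = 0 then 4 * absSin θ else 0) +
          (if b + n = 0 then 4 * absSin θ else 0)) = 4 * absSin θ := by
        rcases lt_or_gt_of_ne hb with h0 | h0
        · rw [if_neg (by omega), if_pos (by omega), zero_add]
        · rw [if_pos (by omega), if_neg (by omega), add_zero]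
      rw [if_pos h, e, e2, show n - b.natAbs = 0 by omega, corrFn_zero, absSin_eq]
      simp only [corrFn, diffPoly, Pi.ofNat_apply]
      field_simp
      ring
    · rw [if_neg (by omega), if_neg (by omega), if_neg (by omega), show n - b.natAbs = 0 by omega,
        show n - (b + 1).natAbs = 0 by omega, show n - (b - 1).natAbs = 0 by omega, corrFn_zero]
      simp
  rw [cf_congr key, cf_const_mul, cf_wave]
  by_cases ha : a = 0 <;> simp [ha]

lemma lap_seedRow_zero (ht : t ∈ trigPoly)
    (happ : ∀ θ, ‖t θ * star (slitFn θ) / 2 - 1‖ ≤ c * ‖cosFn θ‖ ^ n) (hc : 0 ≤ c) (hn : n ≠ 0) :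
    (∀ a, lap (fun a b => cf (seedRow t n b) a) a 0 ∈ Q2) ∧
      ∃ B, ∀ a > B, lap (fun a b => cf (seedRow t n b) a) a 0 = 0 := by
  have key : (4 * seedRow t n 0 - 2 * cosFn * (seedRow t n (0 + 1) + seedRow t n (0 - 1))) =
      star (4 * (star (corrFn t n) - cosFn * star (corrFn t (n - 1)))) := by
    funext θ
    rw [seedRow_rec, if_neg (by omega), if_neg (by omega), star_mul', star_sub, star_mul',
      star_star, star_star, star_cosFn, star_ofNat]
    norm_num
    ring
  have hP : PlusType (4 * (star (corrFn t n) - cosFn * star (corrFn t (n - 1)))) :=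
    ((plusType_star_corrFn ht happ hc le_rfl).sub ((plusType_star_corrFn ht happ hc
      (Nat.sub_le _ _)).trigPoly_mul cosFn_mem_trigPoly)).trigPoly_mul (ofNat_mem _ 4)
  obtain ⟨A, hA⟩ := hP.2
  simp only [lap_seedRow ht happ hc, key, cf_star]
  exact ⟨fun a => star_mem_Q2 (hP.1.2 _), -A, fun a ha => by rw [hA _ (by omega), star_zero]⟩

lemma seedRow_zero_vanish (ht : t ∈ trigPoly)
    (happ : ∀ θ, ‖t θ * star (slitFn θ) / 2 - 1‖ ≤ c * ‖cosFn θ‖ ^ n) (hc : 0 ≤ c) :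
    ∃ A : ℤ, ∀ a < A, cf (seedRow t n 0) a = 0 := by
  have h := (plusType_seed_row ht happ hc).2
  simpa [seedRow] using h

end seeds

lemma lap_add (H K : ℤ → ℤ → ℂ) (a b : ℤ) :
    lap (fun a b => H a b + K a b) a b = lap H a b + lap K a b := by
  simp only [lap]; ring

lemma lap_const_mul (c : ℂ) (H : ℤ → ℤ → ℂ) (a b : ℤ) :
    lap (fun a b => c * H a b) a b = c * lap H a b := by
  simp only [lap]; ring

lemma lap_shift (k : ℤ) (H : ℤ → ℤ → ℂ) (a b : ℤ) :
    lap (fun a b => H (a + k) b) a b = lap H (a + k) b := by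
  simp only [lap, show a + 1 + k = a + k + 1 by ring, show a - 1 + k = a + k - 1 by ring]

/-- `H` is a decaying solution, with values in `Q2`, of the Dirichlet problem for the source `ρ`
in the complement of the slit. -/
structure Solves (H ρ : ℤ → ℤ → ℂ) : Prop where
  mem : ∀ a b, H a b ∈ Q2
  slit : ∀ a ≤ 0, H a 0 = 0
  decays : Decays H
  lap : ∀ a b, (b = 0 → 0 < a) → lap H a b = ρ a b

/-- The Dirichlet problem with source `ρ` has a decaying solution with values in `Q2`. -/
def Solvable (ρ : ℤ → ℤ → ℂ) : Prop := ∃ H, Solves H ρ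

lemma Solvable.congr {ρ ρ' : ℤ → ℤ → ℂ} (h : Solvable ρ)
    (e : ∀ a b, (b = 0 → 0 < a) → ρ a b = ρ' a b) : Solvable ρ' := by
  obtain ⟨H, hH⟩ := h
  exact ⟨H, hH.1, hH.2, hH.3, fun a b hab => (hH.4 a b hab).trans (e a b hab)⟩

lemma Solvable.add {ρ ρ' : ℤ → ℤ → ℂ} (h : Solvable ρ) (h' : Solvable ρ') :
    Solvable fun a b => ρ a b + ρ' a b := by
  obtain ⟨H, hH⟩ := h
  obtain ⟨K, hK⟩ := h'
  refine ⟨fun a b => H a b + K a b, fun a b => add_mem (hH.1 a b) (hK.1 a b), fun a ha => ?_,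
    hH.3.add hK.3, fun a b hab => ?_⟩
  · simp [hH.2 a ha, hK.2 a ha]
  · rw [lap_add, hH.4 a b hab, hK.4 a b hab]

lemma Solvable.const_mul {ρ : ℤ → ℤ → ℂ} (h : Solvable ρ) {c : ℂ} (hc : c ∈ Q2) :
    Solvable fun a b => c * ρ a b := by
  obtain ⟨H, hH⟩ := h
  refine ⟨fun a b => c * H a b, fun a b => mul_mem hc (hH.1 a b), fun a ha => ?_,
    hH.3.const_mul c, fun a b hab => ?_⟩
  · simp [hH.2 a ha]
  · rw [lap_const_mul, hH.4 a b hab]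

lemma Solvable.zero : Solvable fun _ _ => 0 :=
  ⟨fun _ _ => 0, fun _ _ => zero_mem _, fun _ _ => rfl, tendsto_const_nhds, fun a b _ => by
    simp [DiagSlit.lap]⟩

/-- The unit source at the points `(k, n)` and `(k, -n)`. -/
def src (k : ℤ) (n : ℕ) (a b : ℤ) : ℂ := if a = k ∧ b.natAbs = n then 1 else 0

lemma solvable_row {g : ℤ → ℂ} (hg : ∀ a, g a ∈ Q2) (N : ℕ) (hN : ∀ a > (N : ℤ), g a = 0)
    (h : ∀ k : ℕ, 1 ≤ k → k ≤ N → Solvable (src k 0)) :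
    Solvable fun a b => if b = 0 then g a else 0 := by
  induction N generalizing g with
  | zero =>
    refine Solvable.zero.congr fun a b hab => ?_
    split_ifs with hb
    · rw [hN a (by simpa using hab hb)]
    · rfl
  | succ N ih =>
    have h1 := ih (g := fun a => if a = (N + 1 : ℕ) then 0 else g a)
      (fun a => by split_ifs; exacts [zero_mem _, hg a])
      (fun a ha => by
        split_ifs with h2
        · rfl
        · exact hN a (by push_cast at h2 ⊢; omega))
      (fun k hk hkN => h k hk (by omega))
    refine (h1.add ((h (N + 1) (by omega) le_rfl).const_mul (hg (N + 1 : ℕ)))).congr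
      fun a b _ => ?_
    by_cases hb : b = 0
    · by_cases ha : a = (N : ℤ) + 1 <;> simp [src, hb, ha]
    · simp [src, hb]

lemma solvable_src_zero (k : ℕ) (hk : 1 ≤ k) : Solvable (src k 0) := by
  induction k using Nat.strong_induction_on with
  | _ k ih =>
  have h1 : Solvable fun a b => lap tip (a + -k) b := by
    refine ⟨fun a b => tip (a + -k) b, fun a b => tip_mem _ _, fun a ha => tip_of_neg (by omega),
      ?_, fun a b _ => lap_shift _ _ _ _⟩
    simpa using decays_tip.shift (-k) 0
  have h2 : Solvable fun a b => if b = 0 then (if a < k then lap tip (a + -k) 0 else 0) else 0 := by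
    refine solvable_row (fun a => ?_) (k - 1) (fun a ha => ?_) fun j hj hjk =>
      ih j (by omega) hj
    · split_ifs
      exacts [lap_tip_mem _ _, zero_mem _]
    · rw [if_neg (by omega)]
  refine ((h1.add (h2.const_mul (neg_mem (one_mem _)))).const_mul half_mem_Q2).congr
    fun a b _ => ?_
  simp only [src, Int.natAbs_eq_zero]
  by_cases hb : b = 0
  · subst hb
    rcases lt_trichotomy a k with ha | rfl | ha
    · simp [ha, ha.ne]
    · simp [lap_tip_zero]
    · simp [ha.not_gt, ha.ne', lap_tip_of_pos (show 0 < a + -(k : ℤ) by omega)]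
  · simp [hb, lap_tip]

lemma Solvable.src_sub_one {k : ℤ} {n : ℕ} (h : Solvable (src k n)) :
    Solvable (src (k - 1) n) := by
  obtain ⟨H, hH⟩ := h
  refine ⟨fun a b => H (a + 1) b + -H 1 0 * tip a b, fun a b => add_mem (hH.1 _ _)
    (mul_mem (neg_mem (hH.1 _ _)) (tip_mem _ _)), fun a ha => ?_, ?_, fun a b hab => ?_⟩
  · rcases ha.lt_or_eq with ha | rfl
    · simp [tip_of_neg ha, hH.2 (a + 1) (by omega)]
    · simp [tip_zero]
  · have h1 := hH.3.shift 1 0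
    simp only [add_zero] at h1
    exact h1.add (decays_tip.const_mul _)
  · rw [lap_add, lap_const_mul, lap_shift, hH.4 _ _ fun hb => by have := hab hb; omega]
    have h0 : DiagSlit.lap tip a b = 0 := by
      by_cases hb : b = 0
      · subst hb; exact lap_tip_of_pos (hab rfl)
      · simp [lap_tip, hb]
    rw [h0, mul_zero, add_zero]
    simp only [src, eq_sub_iff_add_eq]

lemma exists_solvable_src {n : ℕ} (hn : n ≠ 0) :
    ∃ A : ℤ, ∀ k > A, Solvable (src k n) := by
  obtain ⟨t, ht, c, hc, happ⟩ := exists_trigPoly_approx n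
  obtain ⟨A, hA⟩ := seedRow_zero_vanish ht happ hc
  obtain ⟨hmem, B, hB⟩ := lap_seedRow_zero ht happ hc hn
  set G : ℤ → ℤ → ℂ := fun a b => cf (seedRow t n b) a with hG
  refine ⟨-A, fun k hk => ?_⟩
  have h1 : Solvable fun a b => lap G (a + -k) b := by
    refine ⟨fun a b => G (a + -k) b, fun a b => (qType_seedRow ht happ hc b).2 _,
      fun a ha => hA _ (by omega), ?_, fun a b _ => lap_shift _ _ _ _⟩
    simpa using (decays_seedRow ht happ hc).shift (-k) 0
  have h2 : Solvable fun a b => if b = 0 then lap G (a + -k) 0 else 0 :=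
    solvable_row (fun a => hmem _) (B + k).toNat (fun a ha => hB _ (by omega))
      fun j hj _ => solvable_src_zero j hj
  have h4 : (4⁻¹ : ℂ) ∈ Q2 := by simpa using ratCast_mem_Q2 4⁻¹
  refine ((h1.add (h2.const_mul (neg_mem (one_mem _)))).const_mul h4).congr fun a b _ => ?_
  by_cases hb : b = 0
  · simp [hb, src, hn.symm]
  · rw [if_neg hb, lap_seedRow_of_ne_zero ht happ hc _ hb]
    have e : a + -k = 0 ↔ a = k := by omega
    simp only [src, e]
    split_ifs <;> simp

lemma solvable_src {n : ℕ} (hn : n ≠ 0) (k : ℤ) : Solvable (src k n) := by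
  obtain ⟨A, hA⟩ := exists_solvable_src hn
  have h : ∀ m : ℕ, ∀ k > A - m, Solvable (src k n) := by
    intro m
    induction m with
    | zero => intro k hk; exact hA k (by simpa using hk)
    | succ m ih =>
      intro k hk
      simpa using (ih (k + 1) (by push_cast at hk; omega)).src_sub_one
  exact h (A - k + 1).toNat k (by omega)

/-- The space `ℚ + ℚ / π` inside `ℂ`. -/
noncomputable def QPi : Submodule ℚ ℂ := Submodule.span ℚ {1, (Real.pi : ℂ)⁻¹}

lemma mem_QPi {x : ℂ} : x ∈ QPi ↔ ∃ q r : ℚ, (q : ℂ) + r / Real.pi = x := by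
  simp [QPi, Submodule.mem_span_pair, Rat.smul_def, div_eq_mul_inv]

lemma ratCast_mul_mem_QPi (q : ℚ) {x : ℂ} (hx : x ∈ QPi) : (q : ℂ) * x ∈ QPi := by
  rw [← Rat.smul_def]; exact QPi.smul_mem q hx

lemma mem_QPi_of_recurrence {r : ℤ → ℂ} {a₀ : ℤ} (h0 : r a₀ ∈ QPi)
    (hrec : ∀ a, Even (a - a₀) → r a + r (a + 2) ∈ QPi) (a : ℤ) (ha : Even (a - a₀)) :
    r a ∈ QPi := by
  have hup : ∀ m : ℕ, r (a₀ + 2 * m) ∈ QPi := by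
    intro m
    induction m with
    | zero => simpa using h0
    | succ m ih =>
      have h := QPi.sub_mem (hrec (a₀ + 2 * m) ⟨m, by ring⟩) ih
      rw [add_sub_cancel_left] at h
      convert h using 2
      push_cast; ring
  have hdown : ∀ m : ℕ, r (a₀ - 2 * m) ∈ QPi := by
    intro m
    induction m with
    | zero => simpa using h0
    | succ m ih =>
      have h := hrec (a₀ - 2 * (m + 1 : ℕ)) ⟨-(m + 1 : ℕ), by ring⟩
      rw [show a₀ - 2 * ((m + 1 : ℕ) : ℤ) + 2 = a₀ - 2 * m by push_cast; ring] at h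
      simpa using QPi.sub_mem h ih
  obtain ⟨l, hl⟩ := ha
  rcases le_total 0 l with hl0 | hl0
  · rw [show a = a₀ + 2 * (l.toNat : ℤ) by omega]; exact hup _
  · rw [show a = a₀ - 2 * ((-l).toNat : ℤ) by omega]; exact hdown _

lemma cf_eq_intervalIntegral {ψ : ℝ → ℂ} (hψ : Continuous ψ) (a : ℤ) :
    cf ψ a = (2 * Real.pi : ℂ)⁻¹ * ((∫ θ in (-Real.pi)..0, wave (-a) θ * ψ θ) +
      ∫ θ in (0 : ℝ)..Real.pi, wave (-a) θ * ψ θ) := by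
  have hc : Continuous fun θ => wave (-a) θ * ψ θ := (continuous_wave _).mul hψ
  rw [intervalIntegral.integral_add_adjacent_intervals (hc.intervalIntegrable _ _)
    (hc.intervalIntegrable _ _), intervalIntegral.integral_of_le (by linarith [Real.pi_pos])]
  rfl

lemma cf_neg_of_even {ψ : ℝ → ℂ} (hψ : ∀ θ, ψ (-θ) = ψ θ) (a : ℤ) : cf ψ (-a) = cf ψ a := by
  have hle : -Real.pi ≤ Real.pi := by linarith [Real.pi_pos]
  have h := intervalIntegral.integral_comp_neg (a := -Real.pi) (b := Real.pi)
    fun θ => wave (-a) θ * ψ θ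
  rw [neg_neg, intervalIntegral.integral_of_le hle, intervalIntegral.integral_of_le hle] at h
  have e : ∀ θ, wave (-a) (-θ) * ψ (-θ) = wave (- -a) θ * ψ θ := fun θ => by
    rw [hψ]; congr 1; simp [wave]
  simp only [e] at h
  exact congrArg (fun x => (2 * Real.pi : ℂ)⁻¹ * x) h

lemma wave_pi {a : ℤ} (ha : Even a) : wave a Real.pi = 1 := by
  obtain ⟨m, rfl⟩ := ha
  rw [wave, Complex.exp_eq_one_iff]
  exact ⟨m, by push_cast; ring⟩

lemma wave_neg_pi {a : ℤ} (ha : Even a) : wave a (-Real.pi) = 1 := by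
  obtain ⟨m, rfl⟩ := ha
  rw [wave, Complex.exp_eq_one_iff]
  exact ⟨-m, by push_cast; ring⟩

lemma hasDerivAt_wave (a : ℤ) (θ : ℝ) : HasDerivAt (wave a) (a * Complex.I * wave a θ) θ := by
  have h1 : HasDerivAt (fun θ : ℝ => (a : ℂ) * θ * Complex.I) (a * 1 * Complex.I) θ :=
    ((Complex.ofRealCLM.hasDerivAt (x := θ)).const_mul (a : ℂ)).mul_const Complex.I
  have h2 := h1.cexp
  refine HasDerivAt.congr_deriv (f := wave a) h2 ?_
  simp only [wave]; ring

lemma cf_absSin_mem {a : ℤ} (ha : Even a) : cf absSin a ∈ QPi := by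
  have hpi := Complex.ofReal_ne_zero.2 Real.pi_ne_zero
  have h1 : (a : ℂ) ^ 2 - 1 ≠ 0 := by
    have : a ^ 2 - 1 ≠ 0 := by
      intro h
      have : (a - 1) * (a + 1) = 0 := by linear_combination h
      rcases mul_eq_zero.1 this with h | h <;> · obtain ⟨m, rfl⟩ := ha; omega
    exact_mod_cast this
  set F : ℝ → ℂ := fun θ => wave (-a) θ * ((Real.cos θ : ℝ) + a * Complex.I * (Real.sin θ : ℝ)) /
    ((a : ℂ) ^ 2 - 1) with hF
  have hderiv : ∀ θ, HasDerivAt F (wave (-a) θ * (Real.sin θ : ℝ)) θ := by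
    intro θ
    have h : HasDerivAt F _ θ :=
      (((hasDerivAt_wave (-a) θ).mul ((Real.hasDerivAt_cos θ).ofReal_comp.add
      ((Real.hasDerivAt_sin θ).ofReal_comp.const_mul (a * Complex.I)))).div_const
      ((a : ℂ) ^ 2 - 1))
    refine h.congr_deriv ?_
    rw [div_eq_iff h1]
    simp only [Pi.add_apply]
    push_cast
    linear_combination (-(a : ℂ) ^ 2 * Complex.sin θ * wave (-a) θ) * Complex.I_sq
  have hcont : Continuous fun θ => wave (-a) θ * (Real.sin θ : ℝ) :=
    (continuous_wave _).mul (by fun_prop)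
  have hpos : ∫ θ in (0 : ℝ)..Real.pi, wave (-a) θ * absSin θ = F Real.pi - F 0 := by
    rw [← intervalIntegral.integral_eq_sub_of_hasDerivAt (fun θ _ => hderiv θ)
      (hcont.intervalIntegrable _ _)]
    refine intervalIntegral.integral_congr fun θ hθ => ?_
    rw [Set.uIcc_of_le Real.pi_pos.le] at hθ
    simp only [absSin, abs_of_nonneg (Real.sin_nonneg_of_nonneg_of_le_pi hθ.1 hθ.2)]
  have hneg : ∫ θ in (-Real.pi)..0, wave (-a) θ * absSin θ = -(F 0 - F (-Real.pi)) := by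
    rw [← intervalIntegral.integral_eq_sub_of_hasDerivAt (fun θ _ => hderiv θ)
      (hcont.intervalIntegrable _ _), ← intervalIntegral.integral_neg]
    refine intervalIntegral.integral_congr fun θ hθ => ?_
    rw [Set.uIcc_of_le (by linarith [Real.pi_pos])] at hθ
    simp only [absSin, abs_of_nonpos (Real.sin_nonpos_of_nonpos_of_neg_pi_le hθ.2 hθ.1),
      Complex.ofReal_neg, mul_neg]
  rw [cf_eq_intervalIntegral continuous_absSin, hpos, hneg, mem_QPi]
  refine ⟨0, -2 / ((a : ℚ) ^ 2 - 1), ?_⟩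
  have h0 : wave (-a) 0 = 1 := by simp [wave]
  simp only [hF, wave_pi ha.neg, wave_neg_pi ha.neg, h0]
  simp
  field_simp
  ring

lemma zFn_neg (θ : ℝ) : zFn (-θ) = zFn θ := by
  simp [zFn]

/-- The Fourier coefficients of the powers of `zFn`. -/
noncomputable def zCoeff (k : ℕ) (a : ℤ) : ℂ := cf (zFn ^ k) a

lemma integrable_zFn_pow (k : ℕ) : Integrable (zFn ^ k) circ :=
  integrable_of_continuous (continuous_zFn.pow k)

lemma zCoeff_neg (k : ℕ) (a : ℤ) : zCoeff k (-a) = zCoeff k a :=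
  cf_neg_of_even (fun θ => by rw [Pi.pow_apply, zFn_neg, Pi.pow_apply]) a

lemma zCoeff_zero (a : ℤ) : zCoeff 0 a = if a = 0 then 1 else 0 := by
  rw [zCoeff, pow_zero, ← wave_zero, cf_wave]

lemma zCoeff_one_rec (a : ℤ) :
    zCoeff 1 (a - 1) + zCoeff 1 (a + 1) = 2 * ((if a = 0 then 1 else 0) - cf absSin a) := by
  have h : 2 * cosFn * zFn ^ 1 = (fun _ => 2) * (wave 0 - absSin) := by
    funext θ
    have := cosFn_mul_zFn θ
    simp only [wave_zero, pow_one, Pi.mul_apply, Pi.sub_apply, Pi.ofNat_apply]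
    linear_combination 2 * this
  rw [zCoeff, zCoeff, ← cf_two_mul_cosFn_mul (integrable_zFn_pow 1), h, cf_const_mul,
    cf_sub (integrable_of_continuous (continuous_wave 0))
    (integrable_of_continuous continuous_absSin), cf_wave]

lemma zCoeff_rec (k : ℕ) (a : ℤ) :
    zCoeff (k + 2) (a - 1) + zCoeff (k + 2) (a + 1) =
      4 * zCoeff (k + 1) a - (zCoeff k (a - 1) + zCoeff k (a + 1)) := by
  have h : 2 * cosFn * (zFn ^ (k + 2) + zFn ^ k) = (fun _ => 4) * zFn ^ (k + 1) := by
    funext θ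
    have := cosFn_mul_one_add_zFn_sq θ
    simp only [Pi.mul_apply, Pi.add_apply, Pi.pow_apply, Pi.ofNat_apply]
    linear_combination (2 * zFn θ ^ k) * this
  have h2 := congrArg (fun ψ => cf ψ a) h
  simp only [cf_const_mul] at h2
  rw [cf_two_mul_cosFn_mul ((integrable_zFn_pow _).add (integrable_zFn_pow _)),
    cf_add (integrable_zFn_pow _) (integrable_zFn_pow _),
    cf_add (integrable_zFn_pow _) (integrable_zFn_pow _)] at h2
  simp only [zCoeff]
  linear_combination h2

lemma zCoeff_even_add {k : ℕ} (hk : Even k) : zCoeff k 0 + zCoeff (k + 2) 0 ∈ QPi := by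
  have hk1 : (k + 1 : ℝ) ≠ 0 := by positivity
  set ψ : ℝ → ℝ := fun θ => (1 + (Real.cos θ / (1 + |Real.sin θ|)) ^ 2) *
    (Real.cos θ / (1 + |Real.sin θ|)) ^ k with hψ
  have hψc : Continuous ψ := by
    have h : Continuous fun θ => Real.cos θ / (1 + |Real.sin θ|) :=
      Real.continuous_cos.div (by fun_prop) fun θ => (one_add_abs_sin_pos θ).ne'
    exact (continuous_const.add (h.pow 2)).mul (h.pow k)
  have e : zFn ^ k + zFn ^ (k + 2) = fun θ => (ψ θ : ℂ) := by
    funext θ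
    simp only [Pi.add_apply, Pi.pow_apply, zFn, hψ]
    push_cast; ring
  have hodd : (-1 : ℝ) ^ (k + 1) = -1 := hk.add_one.neg_one_pow
  have hpos : ∫ θ in (0 : ℝ)..Real.pi, ψ θ = 4 / (k + 1) := by
    have hd : ∀ θ ∈ Set.uIcc 0 Real.pi, HasDerivAt (fun θ => -2 / (k + 1 : ℝ) *
        (Real.cos θ / (1 + Real.sin θ)) ^ (k + 1)) (ψ θ) θ := by
      intro θ hθ
      rw [Set.uIcc_of_le Real.pi_pos.le] at hθ
      have hs := Real.sin_nonneg_of_nonneg_of_le_pi hθ.1 hθ.2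
      have h1 : 1 + Real.sin θ ≠ 0 := by positivity
      have h := (((Real.hasDerivAt_cos θ).div ((Real.hasDerivAt_sin θ).const_add 1) h1).pow
        (k + 1)).const_mul (-2 / (k + 1 : ℝ))
      refine HasDerivAt.congr_deriv h ?_
      simp only [hψ, abs_of_nonneg hs, Pi.div_apply, div_pow, Nat.add_sub_cancel]
      push_cast
      have h2 := Real.sin_sq_add_cos_sq θ
      field_simp
      linear_combination Real.cos θ ^ k * h2
    rw [intervalIntegral.integral_eq_sub_of_hasDerivAt hd (hψc.intervalIntegrable _ _)]
    simp [hodd]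
    field_simp
    norm_num
  have hneg : ∫ θ in (-Real.pi)..0, ψ θ = 4 / (k + 1) := by
    have h := intervalIntegral.integral_comp_neg (a := 0) (b := Real.pi) ψ
    rw [neg_zero] at h
    rw [← h, ← hpos]
    congr 1
    funext θ
    simp [hψ]
  have h0 : ∀ θ, wave (-0) θ * (ψ θ : ℂ) = (ψ θ : ℂ) := fun θ => by
    rw [neg_zero, wave_zero]; simp
  rw [zCoeff, zCoeff, ← cf_add (integrable_zFn_pow _) (integrable_zFn_pow _), e,
    cf_eq_intervalIntegral (show Continuous fun θ => (ψ θ : ℂ) from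
      Complex.continuous_ofReal.comp hψc)]
  simp only [h0]
  rw [intervalIntegral.integral_ofReal, intervalIntegral.integral_ofReal, hpos, hneg, mem_QPi]
  have hpi := Complex.ofReal_ne_zero.2 Real.pi_ne_zero
  have hk2 : (k + 1 : ℂ) ≠ 0 := by exact_mod_cast hk1
  refine ⟨0, 4 / (k + 1), ?_⟩
  push_cast
  field_simp
  ring

lemma one_mem_QPi : (1 : ℂ) ∈ QPi := mem_QPi.2 ⟨1, 0, by simp⟩

lemma zCoeff_zero_right_mem (m : ℕ) : zCoeff (m + m) 0 ∈ QPi := by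
  induction m with
  | zero => simpa [zCoeff_zero] using one_mem_QPi
  | succ m ih =>
    have h := QPi.sub_mem (zCoeff_even_add ⟨m, rfl⟩) ih
    rw [add_sub_cancel_left] at h
    convert h using 2
    ring

lemma zCoeff_mem_of_rec {k : ℕ}
    (hrec : ∀ a : ℤ, Even (a + (k + 1)) → zCoeff k (a - 1) + zCoeff k (a + 1) ∈ QPi)
    {a : ℤ} (ha : Even (a + k)) : zCoeff k a ∈ QPi := by
  have hrec' : ∀ a : ℤ, Even (a + k) → zCoeff k a + zCoeff k (a + 2) ∈ QPi := by
    intro a ha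
    have h := hrec (a + 1) (by
      rw [show a + 1 + ((k : ℤ) + 1) = a + k + 2 by ring]; exact ha.add even_two)
    rwa [add_sub_cancel_right, add_assoc] at h
  rcases Nat.even_or_odd k with hk | hk
  · obtain ⟨m, rfl⟩ := hk
    refine mem_QPi_of_recurrence (a₀ := 0) (zCoeff_zero_right_mem m) (fun a ha => hrec' a ?_) a ?_
    · rw [Int.even_sub] at ha; rw [Int.even_add]; simpa using ha
    · rw [Int.even_add] at ha; simpa using ha
  · have hk' : Odd (k : ℤ) := by exact_mod_cast hk
    have h1 : zCoeff k 1 ∈ QPi := by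
      have h := ratCast_mul_mem_QPi 2⁻¹ (hrec' (-1) (hk'.elim fun l hl => ⟨l, by omega⟩))
      have e : zCoeff k (-1) + zCoeff k (-1 + 2) = 2 * zCoeff k 1 := by
        rw [zCoeff_neg]; norm_num; ring
      rw [e] at h
      simpa using h
    refine mem_QPi_of_recurrence (a₀ := 1) h1 (fun a ha => hrec' a ?_) a ?_
    · obtain ⟨m, hm⟩ := ha; obtain ⟨l, hl⟩ := hk'; exact ⟨m + l + 1, by omega⟩
    · obtain ⟨m, hm⟩ := ha; obtain ⟨l, hl⟩ := hk'; exact ⟨m - l - 1, by omega⟩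

lemma zCoeff_mem : ∀ (k : ℕ) {a : ℤ}, Even (a + k) → zCoeff k a ∈ QPi
  | 0, a, _ => by
    rw [zCoeff_zero]; split_ifs
    exacts [one_mem_QPi, QPi.zero_mem]
  | 1, a, ha => by
    refine zCoeff_mem_of_rec (fun a ha => ?_) ha
    rw [zCoeff_one_rec]
    have ha' : Even a := by
      obtain ⟨m, hm⟩ := ha; exact ⟨m - 1, by push_cast at hm; omega⟩
    have h : (if a = 0 then 1 else 0 : ℂ) ∈ QPi := by
      split_ifs
      exacts [one_mem_QPi, QPi.zero_mem]
    simpa using ratCast_mul_mem_QPi 2 (QPi.sub_mem h (cf_absSin_mem ha'))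
  | k + 2, a, ha => by
    refine zCoeff_mem_of_rec (fun a ha => ?_) ha
    obtain ⟨m, hm⟩ := ha
    push_cast at hm
    rw [zCoeff_rec]
    have h1 := ratCast_mul_mem_QPi 4 (zCoeff_mem (k + 1) (a := a) ⟨m - 1, by push_cast; omega⟩)
    have h2 := zCoeff_mem k (a := a - 1) ⟨m - 2, by omega⟩
    have h3 := zCoeff_mem k (a := a + 1) ⟨m - 1, by omega⟩
    exact QPi.sub_mem (by simpa using h1) (QPi.add_mem h2 h3)

/-- The potential of a unit dipole at `(0, 1)` and `(0, -1)`. -/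
noncomputable def dipole (a b : ℤ) : ℂ :=
  b.sign * cf (zFn ^ (b.natAbs - 1) * fun θ => (1 + zFn θ ^ 2) / 4) a

lemma continuous_one_add_zFn_sq : Continuous fun θ => (1 + zFn θ ^ 2) / 4 :=
  (continuous_const.add (continuous_zFn.pow 2)).div_const 4

lemma decays_dipole : Decays dipole := by
  have hg : Tendsto (fun b : ℤ => b.natAbs - 1) cofinite atTop :=
    (tendsto_sub_atTop_nat 1).comp tendsto_natAbs_cofinite
  have h := decays_cf_zFn_pow_mul (integrable_of_continuous continuous_one_add_zFn_sq) hg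
  refine squeeze_zero_norm (fun p => ?_) (tendsto_zero_iff_norm_tendsto_zero.1 h)
  rw [dipole, norm_mul]
  refine mul_le_of_le_one_left (norm_nonneg _) ?_
  rcases lt_trichotomy p.2 0 with hp | hp | hp
  · simp [Int.sign_eq_neg_one_of_neg hp]
  · simp [hp]
  · simp [Int.sign_eq_one_of_pos hp]

lemma dipole_neg (a b : ℤ) : dipole a (-b) = -dipole a b := by
  simp [dipole]

lemma dipole_zero (a : ℤ) : dipole a 0 = 0 := by simp [dipole]

lemma dipole_mem {a b : ℤ} (h : Odd (a + b)) : dipole a b ∈ QPi := by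
  have main : ∀ m : ℕ, Even (a + m) → dipole a (m + 1 : ℕ) ∈ QPi := by
    intro m hm
    have e : (zFn ^ m * fun θ => (1 + zFn θ ^ 2) / 4) =
        (fun _ => 4⁻¹) * (zFn ^ m + zFn ^ (m + 2)) := by
      funext θ
      simp only [Pi.mul_apply, Pi.add_apply, Pi.pow_apply]
      ring
    rw [dipole, Int.natAbs_natCast, Nat.add_sub_cancel, e, cf_const_mul,
      cf_add (integrable_zFn_pow _) (integrable_zFn_pow _), Int.sign_natCast_of_ne_zero (by omega)]
    have h2 : Even (a + (m + 2 : ℕ)) := by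
      push_cast; rw [← add_assoc]; exact hm.add even_two
    simpa [zCoeff] using ratCast_mul_mem_QPi 4⁻¹
      (QPi.add_mem (zCoeff_mem m hm) (zCoeff_mem (m + 2) h2))
  obtain ⟨l, hl⟩ := h
  rcases lt_trichotomy b 0 with hb | rfl | hb
  · have := main (-b - 1).toNat ⟨l - b, by omega⟩
    rw [show (((-b - 1).toNat + 1 : ℕ) : ℤ) = -b by omega, dipole_neg] at this
    simpa using QPi.neg_mem this
  · rw [dipole_zero]; exact QPi.zero_mem
  · have := main (b - 1).toNat ⟨l, by omega⟩
    rwa [show (((b - 1).toNat + 1 : ℕ) : ℤ) = b by omega] at this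

lemma lap_dipole (a b : ℤ) : lap dipole a b =
    (if a = 0 ∧ b = 1 then 1 else 0) - (if a = 0 ∧ b = -1 then 1 else 0) := by
  set φ : ℤ → ℝ → ℂ := fun b => (fun _ => (b.sign : ℂ)) * (zFn ^ (b.natAbs - 1) *
    fun θ => (1 + zFn θ ^ 2) / 4) with hφ
  have hi : ∀ b, Integrable (φ b) circ := fun b => integrable_const_mul _
    (integrable_zFn_pow_mul (integrable_of_continuous continuous_one_add_zFn_sq) _)
  have h : dipole = fun a b => cf (φ b) a := by
    funext a b; simp only [hφ]; rw [cf_const_mul, dipole]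
  rw [h, lap_cf hi]
  have key : 4 * φ b - 2 * cosFn * (φ (b + 1) + φ (b - 1)) =
      (fun _ => (if b = 1 then 1 else 0) - (if b = -1 then 1 else 0)) * wave 0 := by
    funext θ
    have h1 := cosFn_mul_zFn θ
    have h2 := cosFn_mul_one_add_zFn_sq θ
    have h3 := one_add_zFn_sq_mul θ
    have hcase : b = 0 ∨ b = 1 ∨ b = -1 ∨ ∃ k : ℕ, b = k + 2 ∨ b = -(k + 2) := by
      by_cases h : b.natAbs ≤ 1
      · omega
      · exact .inr (.inr (.inr ⟨b.natAbs - 2, by omega⟩))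
    simp only [hφ, wave_zero, Pi.mul_apply, Pi.sub_apply, Pi.add_apply, Pi.pow_apply,
      Pi.ofNat_apply]
    rcases hcase with rfl | rfl | rfl | ⟨k, rfl | rfl⟩
    · norm_num
    · norm_num [show Int.sign 2 = 1 from rfl]
      linear_combination (-(1 + zFn θ ^ 2) / 2) * h1 + h3 / 2
    · norm_num [show Int.sign 2 = 1 from rfl]
      linear_combination ((1 + zFn θ ^ 2) / 2) * h1 - h3 / 2
    · rw [show ((k : ℤ) + 2 - 1) = (k + 1 : ℕ) by push_cast; ring,
        show ((k : ℤ) + 2 + 1) = (k + 3 : ℕ) by push_cast; ring,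
        show ((k : ℤ) + 2) = (k + 2 : ℕ) by push_cast; ring, if_neg (by omega), if_neg (by omega),
        Int.sign_natCast_of_ne_zero (by omega), Int.sign_natCast_of_ne_zero (by omega),
        Int.sign_natCast_of_ne_zero (by omega)]
      simp only [Int.natAbs_natCast, Nat.add_sub_cancel, show k + 2 - 1 = k + 1 by omega,
        show k + 3 - 1 = k + 2 by omega]
      push_cast
      linear_combination (-(1 + zFn θ ^ 2) / 2 * zFn θ ^ k) * h2
    · rw [show (-((k : ℤ) + 2) - 1) = -(k + 3 : ℕ) by push_cast; ring,
        show (-((k : ℤ) + 2) + 1) = -(k + 1 : ℕ) by push_cast; ring,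
        show -((k : ℤ) + 2) = -(k + 2 : ℕ) by push_cast; ring, if_neg (by omega),
        if_neg (by omega), Int.sign_neg, Int.sign_neg, Int.sign_neg,
        Int.sign_natCast_of_ne_zero (by omega), Int.sign_natCast_of_ne_zero (by omega),
        Int.sign_natCast_of_ne_zero (by omega)]
      simp only [Int.natAbs_neg, Int.natAbs_natCast, Nat.add_sub_cancel,
        show k + 2 - 1 = k + 1 by omega, show k + 3 - 1 = k + 2 by omega]
      push_cast
      linear_combination ((1 + zFn θ ^ 2) / 2 * zFn θ ^ k) * h2
  rw [key, cf_const_mul, cf_wave]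
  by_cases ha : a = 0 <;> simp [ha]

/-- The decaying potential of a unit charge at `(a₀, n)` and its mirror charge at `(a₀, -n)`. -/
noncomputable def mirror (a₀ : ℤ) (n : ℕ) (a b : ℤ) : ℂ :=
  ∑ i ∈ Finset.range n, dipole (a - a₀) (b - n + 1 + 2 * i)

lemma mirror_mem {a₀ a b : ℤ} {n : ℕ} (h0 : Even (a₀ + n)) (h : Even (a + b)) :
    mirror a₀ n a b ∈ QPi := by
  refine QPi.sum_mem fun i _ => dipole_mem ?_
  obtain ⟨k, hk⟩ := h0
  obtain ⟨l, hl⟩ := h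
  exact ⟨l - k + i, by linear_combination hl - hk⟩

lemma mirror_zero (a₀ a : ℤ) (n : ℕ) : mirror a₀ n a 0 = 0 := by
  have h := Finset.sum_range_reflect (fun i : ℕ => dipole (a - a₀) (0 - n + 1 + 2 * i)) n
  have h2 : ∑ i ∈ Finset.range n, dipole (a - a₀) (0 - n + 1 + 2 * (n - 1 - i : ℕ)) =
      -mirror a₀ n a 0 := by
    rw [mirror, ← Finset.sum_neg_distrib]
    refine Finset.sum_congr rfl fun i hi => ?_
    rw [← dipole_neg]
    have := Finset.mem_range.1 hi
    congr 1; omega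
  have h3 : mirror a₀ n a 0 = -mirror a₀ n a 0 := h.symm.trans h2
  exact self_eq_neg.1 h3

lemma decays_mirror (a₀ : ℤ) (n : ℕ) : Decays (mirror a₀ n) := by
  have h : ∀ i ∈ Finset.range n, Tendsto (fun p : ℤ × ℤ =>
      dipole (p.1 - a₀) (p.2 - n + 1 + 2 * i)) cofinite (𝓝 0) := by
    intro i _
    have h := decays_dipole.shift (-a₀) (-n + 1 + 2 * i)
    simp only [Decays, ← sub_eq_add_neg, ← add_assoc] at h
    exact h
  simpa [Decays, mirror] using tendsto_finsetSum _ h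

lemma lap_mirror (a₀ : ℤ) (n : ℕ) (a b : ℤ) : lap (mirror a₀ n) a b =
    (if a = a₀ ∧ b = n then 1 else 0) - (if a = a₀ ∧ b = -n then 1 else 0) := by
  have h1 : lap (mirror a₀ n) a b =
      ∑ i ∈ Finset.range n, lap dipole (a - a₀) (b - n + 1 + 2 * i) := by
    simp only [lap, mirror, Finset.mul_sum, ← Finset.sum_add_distrib, ← Finset.sum_sub_distrib]
    refine Finset.sum_congr rfl fun i _ => ?_
    simp only [show a + 1 - a₀ = a - a₀ + 1 by ring, show a - 1 - a₀ = a - a₀ - 1 by ring,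
      show b + 1 - n + 1 + 2 * (i : ℤ) = b - n + 1 + 2 * i + 1 by ring,
      show b - 1 - n + 1 + 2 * (i : ℤ) = b - n + 1 + 2 * i - 1 by ring]
  set f : ℕ → ℂ := fun i => if a = a₀ ∧ b = n - 2 * i then 1 else 0 with hf
  have h2 : ∀ i : ℕ, lap dipole (a - a₀) (b - n + 1 + 2 * i) = f i - f (i + 1) := by
    intro i
    have e0 : a - a₀ = 0 ↔ a = a₀ := by omega
    have e1 : b - n + 1 + 2 * (i : ℤ) = 1 ↔ b = n - 2 * i := by omega
    have e2 : b - n + 1 + 2 * (i : ℤ) = -1 ↔ b = n - 2 * (i + 1 : ℕ) := by push_cast; omega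
    simp only [lap_dipole, hf, e0, e1, e2]
  rw [h1, Finset.sum_congr rfl fun i _ => h2 i, Finset.sum_range_sub']
  have e3 : (n : ℤ) - 2 * n = -n := by ring
  simp only [hf, Nat.cast_zero, mul_zero, sub_zero, e3]

lemma exists_potential (a₀ b₀ : ℤ) (h0 : b₀ = 0 → 0 < a₀) (hp : Even (a₀ + b₀)) :
    ∃ G : ℤ → ℤ → ℂ, Decays G ∧ (∀ a ≤ 0, G a 0 = 0) ∧
      (∀ a b, (b = 0 → 0 < a) → lap G a b = if a = a₀ ∧ b = b₀ then 1 else 0) ∧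
      ∀ a b, Even (a + b) → ∃ x ∈ Q2, ∃ y ∈ QPi, G a b = x + y := by
  by_cases hb : b₀ = 0
  · subst hb
    have ha := h0 rfl
    obtain ⟨S, hS⟩ := solvable_src_zero a₀.toNat (by omega)
    refine ⟨S, hS.decays, hS.slit, fun a b hab => ?_,
      fun a b _ => ⟨_, hS.mem a b, 0, QPi.zero_mem, (add_zero _).symm⟩⟩
    rw [hS.lap a b hab, src, Int.toNat_of_nonneg ha.le]
    simp only [Int.natAbs_eq_zero]
  · have hn : b₀.natAbs ≠ 0 := Int.natAbs_ne_zero.2 hb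
    obtain ⟨S, hS⟩ := solvable_src hn a₀
    have hn0 : Even (a₀ + b₀.natAbs) := by
      rw [Int.even_add] at hp ⊢
      rwa [Int.even_coe_nat, Int.natAbs_even]
    refine ⟨fun a b => 2⁻¹ * S a b + 2⁻¹ * ((b₀.sign : ℂ) * mirror a₀ b₀.natAbs a b),
      (hS.decays.const_mul _).add (((decays_mirror _ _).const_mul _).const_mul _),
      fun a ha => by simp only [hS.slit a ha, mirror_zero, mul_zero, add_zero], fun a b hab => ?_,
      fun a b hab => ?_⟩
    · rw [lap_add, lap_const_mul, lap_const_mul, lap_const_mul, hS.lap a b hab, lap_mirror, src]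
      by_cases ha : a = a₀
      · have e : b.natAbs = b₀.natAbs ↔ b = b₀ ∨ b = -b₀ := Int.natAbs_eq_natAbs_iff
        rcases lt_or_gt_of_ne hb with hneg | hpos
        · have e1 : (b₀.natAbs : ℤ) = -b₀ := by omega
          simp only [ha, true_and, e, e1, neg_neg, Int.sign_eq_neg_one_of_neg hneg]
          by_cases h1 : b = b₀
          · rw [h1]
            simp only [true_or, if_true, if_neg (show b₀ ≠ -b₀ by omega)]
            norm_num
          · by_cases h2 : b = -b₀ <;> simp [h1, h2, show -b₀ ≠ b₀ by omega]
        · have e1 : (b₀.natAbs : ℤ) = b₀ := by omega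
          simp only [ha, true_and, e, e1, Int.sign_eq_one_of_pos hpos]
          by_cases h1 : b = b₀
          · rw [h1]
            simp only [true_or, if_true, if_neg (show b₀ ≠ -b₀ by omega)]
            norm_num
          · by_cases h2 : b = -b₀ <;> simp [h1, h2, show -b₀ ≠ b₀ by omega]
      · simp [ha]
    · refine ⟨_, Q2.mul_mem (ratCast_mem_Q2 2⁻¹) (hS.mem a b), _,
        ratCast_mul_mem_QPi 2⁻¹ (ratCast_mul_mem_QPi b₀.sign (mirror_mem hn0 hab)), ?_⟩
      push_cast; rfl

lemma nonpos_of_harmonic {d : ℤ × ℤ → ℝ} (hlim : Tendsto d cofinite (𝓝 0))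
    (h0 : ∀ v ∈ D0, d v = 0)
    (hd : ∀ v ∉ D0, 4 * d v -
      (d (v.1 + 1, v.2) + d (v.1 - 1, v.2) + d (v.1, v.2 + 1) + d (v.1, v.2 - 1)) = 0)
    (v : ℤ × ℤ) : d v ≤ 0 := by
  by_contra! hv
  have hfin : {w | d v ≤ d w}.Finite := by
    have h := hlim.eventually (gt_mem_nhds hv)
    rw [eventually_cofinite] at h
    simpa only [not_lt] using h
  obtain ⟨m, hm, hmax⟩ := hfin.exists_maximalFor d _ ⟨v, le_rfl (a := d v)⟩
  have hle : ∀ w, d w ≤ d m := fun w => by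
    rcases le_total (d v) (d w) with h | h
    · rcases le_total (d w) (d m) with h' | h'
      · exact h'
      · exact hmax h h'
    · exact h.trans hm
  have hfin' : {w | d w = d m}.Finite := hfin.subset fun w hw => hm.trans hw.ge
  obtain ⟨x, hx, hxmax⟩ := hfin'.exists_maximalFor Prod.fst _ ⟨m, rfl⟩
  have hx' : d x = d m := hx
  have hm0 : 0 < d m := hv.trans_le hm
  have hxD : x ∉ D0 := fun h => by rw [← hx', h0 x h] at hm0; exact hm0.false
  have hstep : d (x.1 + 1, x.2) = d m := by
    refine le_antisymm (hle _) ?_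
    linarith [hd x hxD, hle (x.1 - 1, x.2), hle (x.1, x.2 + 1), hle (x.1, x.2 - 1)]
  have := hxmax hstep (by simp)
  simp at this

end DiagSlit

/-- Values of the Green's function of `ℤ²` with Dirichlet boundary on the diagonal ray
`D₀` lie in `ℚ + √2·ℚ + (1/π)·ℚ`: if `h` is bounded, vanishes on `D₀`, tends to `0`
at infinity, and has lattice Laplacian equal to the delta function at a source
`u ∉ D₀` off the ray, then every value of `h` is of the form `q₁ + q₂·√2 + q₃/π`
with `q₁, q₂, q₃` rational. -/
theorem diagSlitGreen_values (u : ℤ × ℤ) (hu : u ∉ D0) (h : ℤ × ℤ → ℝ)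
    (hbd : ∃ C : ℝ, ∀ v : ℤ × ℤ, |h v| ≤ C)
    (h0 : ∀ v ∈ D0, h v = 0)
    (hlim : Filter.Tendsto h Filter.cofinite (nhds 0))
    (hlap : ∀ v : ℤ × ℤ, v ∉ D0 →
      4 * h v -
          (h (v.1 + 1, v.2) + h (v.1 - 1, v.2) + h (v.1, v.2 + 1) + h (v.1, v.2 - 1)) =
        if v = u then 1 else 0) :
    ∀ w : ℤ × ℤ, ∃ q₁ q₂ q₃ : ℚ,
      h w = (q₁ : ℝ) + (q₂ : ℝ) * Real.sqrt 2 + (q₃ : ℝ) / Real.pi := by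
  have hD0 : ∀ v : ℤ × ℤ, v ∉ D0 → v.1 - v.2 = 0 → 0 < v.1 + v.2 := by
    intro v hv hv0
    by_contra! hle
    exact hv ⟨by omega, by omega⟩
  obtain ⟨G, hG, hG0, hGlap, hGmem⟩ := DiagSlit.exists_potential (u.1 + u.2) (u.1 - u.2) (hD0 u hu)
    ⟨u.1, by ring⟩
  set g : ℤ × ℤ → ℝ := fun v => (G (v.1 + v.2) (v.1 - v.2)).re with hg
  have hglim : Filter.Tendsto g Filter.cofinite (nhds 0) := by
    have hinj : Function.Injective fun v : ℤ × ℤ => (v.1 + v.2, v.1 - v.2) := by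
      intro v w hvw
      obtain ⟨h1, h2⟩ := Prod.mk.inj hvw
      exact Prod.ext (by omega) (by omega)
    have := (Complex.continuous_re.tendsto 0).comp (hG.comp hinj.tendsto_cofinite)
    rwa [Complex.zero_re] at this
  have hg0 : ∀ v ∈ D0, g v = 0 := by
    rintro v ⟨hv1, hv2⟩
    simp only [hg]
    rw [show v.1 - v.2 = 0 by omega, hG0 _ (by omega), Complex.zero_re]
  have hglap : ∀ v : ℤ × ℤ, v ∉ D0 →
      4 * g v - (g (v.1 + 1, v.2) + g (v.1 - 1, v.2) + g (v.1, v.2 + 1) + g (v.1, v.2 - 1)) =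
        if v = u then 1 else 0 := by
    intro v hv
    have e : (v.1 + v.2 = u.1 + u.2 ∧ v.1 - v.2 = u.1 - u.2) ↔ v = u := by
      rw [Prod.ext_iff]; omega
    have hre : ∀ z : ℂ, (4 * z).re = 4 * z.re := fun z => by simp
    have h1 := congrArg Complex.re (hGlap (v.1 + v.2) (v.1 - v.2) (hD0 v hv))
    simp only [DiagSlit.lap, e, apply_ite Complex.re, Complex.sub_re, Complex.add_re,
      Complex.one_re, Complex.zero_re, hre] at h1
    simp only [hg, show v.1 + 1 + v.2 = v.1 + v.2 + 1 by ring,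
      show v.1 + 1 - v.2 = v.1 - v.2 + 1 by ring, show v.1 - 1 + v.2 = v.1 + v.2 - 1 by ring,
      show v.1 - 1 - v.2 = v.1 - v.2 - 1 by ring, show v.1 + (v.2 + 1) = v.1 + v.2 + 1 by ring,
      show v.1 - (v.2 + 1) = v.1 - v.2 - 1 by ring, show v.1 + (v.2 - 1) = v.1 + v.2 - 1 by ring,
      show v.1 - (v.2 - 1) = v.1 - v.2 + 1 by ring]
    rw [← h1]
  intro w
  have hle : h w - g w ≤ 0 := DiagSlit.nonpos_of_harmonic (d := fun v => h v - g v)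
    (by simpa using hlim.sub hglim) (fun v hv => by rw [h0 v hv, hg0 v hv, sub_zero])
    (fun v hv => by linarith [hlap v hv, hglap v hv]) w
  have hge : g w - h w ≤ 0 := DiagSlit.nonpos_of_harmonic (d := fun v => g v - h v)
    (by simpa using hglim.sub hlim) (fun v hv => by rw [h0 v hv, hg0 v hv, sub_zero])
    (fun v hv => by linarith [hlap v hv, hglap v hv]) w
  obtain ⟨x, ⟨q₁, q₂, hx⟩, y, hy, hxy⟩ := hGmem (w.1 + w.2) (w.1 - w.2) ⟨w.1, by ring⟩
  obtain ⟨r₁, r₂, hr⟩ := DiagSlit.mem_QPi.1 hy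
  refine ⟨q₁ + r₁, q₂, r₂, ?_⟩
  have hgw : g w = (q₁ + q₂ * Real.sqrt 2) + (r₁ + r₂ / Real.pi) := by
    have : (G (w.1 + w.2) (w.1 - w.2)) =
        (((q₁ + q₂ * Real.sqrt 2) + (r₁ + r₂ / Real.pi) : ℝ) : ℂ) := by
      rw [hxy, hx, ← hr]; push_cast; rfl
    simp only [hg, this, Complex.ofReal_re]
  push_cast
  linarith
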